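/- arXiv:math/0205153 — 3 statements merged into one kernel-verified Lean document; each statement's English description precedes it below -/
import Mathlib

section
/- For every p with 1 ≤ p ≤ 2 there is a constant C (depending only on d, p, and β_0) such that for all k ∈ ℤ, every subset 𝓔 ⊆ [2^k, 2^{k+1}], all j ≥ 10, and every Schwartz function f on ℝ^d: ‖ sup_{t∈𝓔} |A_t^j f| ‖_{L^p} ≤ C N(𝓔, 2^{k−j})^{1/p} 2^{−j(d−1)/p'} ‖f‖_{L^p}, where p' = p/(p−1). -/
open MeasureTheory Metric Set Filter
open scoped ENNReal NNReal Topology RealInnerProductSpace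

noncomputable section

abbrev Ed (d : ℕ) := EuclideanSpace ℝ (Fin d)

/-- The rotation-invariant probability measure on the unit sphere. -/
def sphereProb (d : ℕ) : Measure (sphere (0 : Ed d) 1) :=
  ((volume : Measure (Ed d)).toSphere Set.univ)⁻¹ • (volume : Measure (Ed d)).toSphere

def eChar (r : ℝ) : ℂ := Complex.exp ((r : ℂ) * Complex.I)

/-- The Fourier transform `\widehat{dσ}` of the sphere measure. -/
def sigmaHat (d : ℕ) (ξ : Ed d) : ℂ :=
  ∫ y : sphere (0 : Ed d) 1, eChar (-(2 * Real.pi * ⟪ξ, (y : Ed d)⟫)) ∂(sphereProb d)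

/-- The Fourier transform `\hat f`. -/
def fourierInt (d : ℕ) (f : Ed d → ℂ) (ξ : Ed d) : ℂ :=
  ∫ x : Ed d, eChar (-(2 * Real.pi * ⟪ξ, x⟫)) * f x

/-- `β₀ ∈ C_c^∞` is radial, `≡ 1` on `{|ξ| ≤ 1}` and `≡ 0` on `{|ξ| ≥ 2}`. -/
def IsAdmissibleBump (d : ℕ) (β0 : Ed d → ℝ) : Prop :=
  ContDiff ℝ (⊤ : ℕ∞) β0 ∧ HasCompactSupport β0 ∧
  (∀ ξ η : Ed d, ‖ξ‖ = ‖η‖ → β0 ξ = β0 η) ∧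
  (∀ ξ : Ed d, ‖ξ‖ ≤ 1 → β0 ξ = 1) ∧ (∀ ξ : Ed d, 2 ≤ ‖ξ‖ → β0 ξ = 0)

/-- `β_j(ξ) = β₀(2^{-j} ξ) - β₀(2^{1-j} ξ)`. -/
def betaJ (d : ℕ) (β0 : Ed d → ℝ) (j : ℕ) (ξ : Ed d) : ℝ :=
  β0 ((2:ℝ) ^ (-(j:ℤ)) • ξ) - β0 ((2:ℝ) ^ (1 - (j:ℤ)) • ξ)

/-- The frequency-localized spherical mean `A_t^j f`, defined via the Fourier
multiplier `\widehat{dσ}(tξ) β_j(tξ)`. -/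
def Aj (d : ℕ) (β0 : Ed d → ℝ) (j : ℕ) (t : ℝ) (f : Ed d → ℂ) (x : Ed d) : ℂ :=
  ∫ ξ : Ed d, eChar (2 * Real.pi * ⟪ξ, x⟫) *
    (sigmaHat d (t • ξ) * (betaJ d β0 j (t • ξ) : ℂ) * fourierInt d f ξ)

/-- `B_t^j f = (∂/∂t) A_t^j f`. -/
def Bj (d : ℕ) (β0 : Ed d → ℝ) (j : ℕ) (t : ℝ) (f : Ed d → ℂ) (x : Ed d) : ℂ :=
  deriv (fun s : ℝ => Aj d β0 j s f x) t

/-- `N(S,δ)`: minimal number of intervals of length `δ` needed to cover `S`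
(with the value `1` for the empty set). -/
def covN (S : Set ℝ) (δ : ℝ) : ℕ :=
  max 1 (sInf {n : ℕ | ∃ c : Fin n → ℝ, S ⊆ ⋃ i, Set.Icc (c i) (c i + δ)})

/-- `sup_{t ∈ S} |A_t^j f(x)|`, valued in `ℝ≥0∞`. -/
def supAj (d : ℕ) (β0 : Ed d → ℝ) (j : ℕ) (S : Set ℝ) (f : Ed d → ℂ) (x : Ed d) : ℝ≥0∞ :=
  ⨆ t ∈ S, (‖Aj d β0 j t f x‖₊ : ℝ≥0∞)

lemma norm_eChar (r : ℝ) : ‖eChar r‖ = 1 := Complex.norm_exp_ofReal_mul_I r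

lemma eChar_add (r s : ℝ) : eChar (r + s) = eChar r * eChar s := by
  simp only [eChar, ← Complex.exp_add]
  congr 1
  push_cast
  ring

@[fun_prop]
lemma continuous_eChar : Continuous eChar := by
  unfold eChar
  fun_prop

lemma fourierChar_eq_eChar (r : ℝ) : (Real.fourierChar r : ℂ) = eChar (2 * Real.pi * r) := by
  rw [Real.fourierChar_apply, eChar]

lemma isProbabilityMeasure_sphereProb {d : ℕ} (hd : 2 ≤ d) :
    IsProbabilityMeasure (sphereProb d) := by
  have : Nonempty (Fin d) := ⟨⟨0, by omega⟩⟩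
  have : Nontrivial (Ed d) := inferInstance
  constructor
  rw [sphereProb, Measure.smul_apply, smul_eq_mul]
  exact ENNReal.inv_mul_cancel
    (mt Measure.measure_univ_eq_zero.1 (volume : Measure (Ed d)).toSphere_ne_zero)
    (measure_ne_top _ _)

/-- The sphere measure, viewed as a measure on the ambient space. -/
def sphereLaw (d : ℕ) : Measure (Ed d) := (sphereProb d).map Subtype.val

lemma isProbabilityMeasure_sphereLaw {d : ℕ} (hd : 2 ≤ d) :
    IsProbabilityMeasure (sphereLaw d) := by
  have := isProbabilityMeasure_sphereProb hd
  exact Measure.isProbabilityMeasure_map measurable_subtype_coe.aemeasurable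

lemma ae_norm_eq_one_sphereLaw (d : ℕ) : ∀ᵐ y ∂sphereLaw d, ‖y‖ = 1 := by
  rw [sphereLaw, ae_map_iff measurable_subtype_coe.aemeasurable
    (measurableSet_eq_fun (by fun_prop) (by fun_prop))]
  exact Eventually.of_forall fun y => by simp

open scoped Pointwise in
lemma sphereLaw_map (d : ℕ) (e : Ed d ≃ₗᵢ[ℝ] Ed d) : (sphereLaw d).map e = sphereLaw d := by
  have he : Measurable e := e.continuous.measurable
  ext A hA
  have hA' : MeasurableSet (e ⁻¹' A) := he hA
  rw [Measure.map_apply he hA, sphereLaw, Measure.map_apply measurable_subtype_coe hA,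
    Measure.map_apply measurable_subtype_coe hA', sphereProb, Measure.smul_apply,
    Measure.smul_apply, Measure.toSphere_apply' _ (measurable_subtype_coe hA),
    Measure.toSphere_apply' _ (measurable_subtype_coe hA')]
  congr 2
  have hset : Ioo (0 : ℝ) 1 •
        (Subtype.val '' (Subtype.val ⁻¹' (e ⁻¹' A) : Set (sphere (0 : Ed d) 1)))
      = e ⁻¹' (Ioo (0 : ℝ) 1 •
        (Subtype.val '' (Subtype.val ⁻¹' A : Set (sphere (0 : Ed d) 1)))) := by
    ext x
    simp only [Set.mem_smul, mem_image, mem_preimage]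
    constructor
    · rintro ⟨r, hr, _, ⟨y, hyA, rfl⟩, rfl⟩
      exact ⟨r, hr, e y, ⟨⟨e y, by simp⟩, hyA, rfl⟩, by simp⟩
    · rintro ⟨r, hr, _, ⟨y, hyA, rfl⟩, h⟩
      refine ⟨r, hr, e.symm y, ⟨⟨e.symm y, by simp⟩, by simpa using hyA, rfl⟩, ?_⟩
      apply e.injective
      simp [← h]
  rw [hset]
  exact (e.measurePreserving.measure_preimage_equiv (f := e.toMeasurableEquiv) _)

/-- The Fourier transform of the weighted sphere measure `w dσ`. -/
def weightedSigmaHat (d : ℕ) (w : Ed d → ℂ) (ξ : Ed d) : ℂ :=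
  ∫ y, w y * eChar (-(2 * Real.pi * ⟪ξ, y⟫)) ∂sphereLaw d

lemma sigmaHat_eq_weighted (d : ℕ) : sigmaHat d = weightedSigmaHat d 1 := by
  ext ξ
  rw [sigmaHat, weightedSigmaHat, sphereLaw, integral_map measurable_subtype_coe.aemeasurable]
  · simp
  · exact Continuous.aestronglyMeasurable (by simp; fun_prop)

lemma weightedSigmaHat_eq_fourierIntegral (d : ℕ) (w : Ed d → ℂ) :
    weightedSigmaHat d w = VectorFourier.fourierIntegral Real.fourierChar (sphereLaw d)
      (innerSL ℝ : Ed d →L[ℝ] Ed d →L[ℝ] ℝ).toLinearMap₁₂ w := by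
  ext ξ
  rw [weightedSigmaHat, VectorFourier.fourierIntegral]
  congr 1
  ext y
  rw [Circle.smul_def, fourierChar_eq_eChar, smul_eq_mul, mul_comm]
  simp [real_inner_comm]

lemma integrable_sphereLaw {d : ℕ} (hd : 2 ≤ d) {w : Ed d → ℂ} (hw : Continuous w) :
    Integrable w (sphereLaw d) := by
  have := isProbabilityMeasure_sphereLaw hd
  obtain ⟨C, hC⟩ := (isCompact_sphere (0 : Ed d) 1).exists_bound_of_continuousOn hw.continuousOn
  refine Integrable.of_bound hw.aestronglyMeasurable C ?_
  filter_upwards [ae_norm_eq_one_sphereLaw d] with y hy using hC y (by simpa using hy)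

lemma contDiff_sigmaHat {d : ℕ} (hd : 2 ≤ d) : ContDiff ℝ (⊤ : ℕ∞) (sigmaHat d) := by
  have := isProbabilityMeasure_sphereLaw hd
  rw [sigmaHat_eq_weighted, weightedSigmaHat_eq_fourierIntegral]
  apply VectorFourier.contDiff_fourierIntegral
  intro n _
  refine Integrable.of_bound (Continuous.aestronglyMeasurable (by simp; fun_prop)) 1 ?_
  filter_upwards [ae_norm_eq_one_sphereLaw d] with y hy
  simp [hy]

lemma hasDerivAt_weightedSigmaHat {d : ℕ} (hd : 2 ≤ d) {w : Ed d → ℂ} (hw : Continuous w)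
    {γ : ℝ → Ed d} {v : Ed d} {θ : ℝ} (hγ : HasDerivAt γ v θ) :
    HasDerivAt (fun s => weightedSigmaHat d w (γ s))
      (weightedSigmaHat d (fun y => -(2 * Real.pi * Complex.I) * ⟪v, y⟫ * w y) (γ θ)) θ := by
  have h := VectorFourier.hasFDerivAt_fourierIntegral (innerSL ℝ : Ed d →L[ℝ] Ed d →L[ℝ] ℝ)
    (integrable_sphereLaw hd hw)
    (by
      have := (integrable_sphereLaw hd (w := fun y => (‖y‖ : ℂ) * w y) (by fun_prop)).norm
      simpa using this) (γ θ)
  have h2 := h.comp_hasDerivAt θ hγ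
  rw [weightedSigmaHat_eq_fourierIntegral, weightedSigmaHat_eq_fourierIntegral]
  refine h2.congr_deriv ?_
  rw [VectorFourier.fourierIntegral, ContinuousLinearMap.integral_apply]
  · rw [VectorFourier.fourierIntegral]
    congr 1
    ext y
    rw [Circle.smul_def, _root_.smul_apply, VectorFourier.fourierSMulRight_apply]
    have hv : (innerSL ℝ : Ed d →L[ℝ] Ed d →L[ℝ] ℝ) y v = ⟪v, y⟫ := real_inner_comm v y
    simp only [Circle.smul_def, smul_eq_mul, Complex.real_smul, hv]
    ring
  · have : Integrable (VectorFourier.fourierSMulRight (innerSL ℝ : Ed d →L[ℝ] Ed d →L[ℝ] ℝ) w)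
        (sphereLaw d) := by
      have hi := (integrable_sphereLaw hd (w := fun y => (‖y‖ : ℂ) * w y) (by fun_prop)).norm
      refine (hi.const_mul (2 * Real.pi * ‖(innerSL ℝ : Ed d →L[ℝ] Ed d →L[ℝ] ℝ)‖)).mono'
        hw.aestronglyMeasurable.fourierSMulRight (Eventually.of_forall fun y => ?_)
      refine (VectorFourier.norm_fourierSMulRight_le _ _ _).trans (le_of_eq ?_)
      simp [mul_assoc]
    exact (VectorFourier.fourierIntegral_convergent_iff Real.continuous_fourierChar
      (by apply (innerSL ℝ : Ed d →L[ℝ] Ed d →L[ℝ] ℝ).continuous₂) _).2 this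

lemma sigmaHat_eq_of_norm_eq (d : ℕ) {ξ η : Ed d} (h : ‖ξ‖ = ‖η‖) :
    sigmaHat d ξ = sigmaHat d η := by
  let e : Ed d ≃ₗᵢ[ℝ] Ed d := (ℝ ∙ (ξ - η))ᗮ.reflection
  have he : e ξ = η := Submodule.reflection_sub h
  rw [sigmaHat_eq_weighted, weightedSigmaHat, weightedSigmaHat]
  conv_rhs => rw [← sphereLaw_map d e]
  rw [integral_map e.continuous.measurable.aemeasurable]
  · simp only [← he, LinearIsometryEquiv.inner_map_map]
    rfl
  · exact Continuous.aestronglyMeasurable (by simp; fun_prop)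

lemma weightedSigmaHat_linearCombination {d : ℕ} (hd : 2 ≤ d) {w₁ w₂ : Ed d → ℂ}
    (h₁ : Continuous w₁) (h₂ : Continuous w₂) (c₁ c₂ : ℂ) (ξ : Ed d) :
    weightedSigmaHat d (fun y => c₁ * w₁ y + c₂ * w₂ y) ξ =
      c₁ * weightedSigmaHat d w₁ ξ + c₂ * weightedSigmaHat d w₂ ξ := by
  simp only [weightedSigmaHat, ← integral_const_mul]
  rw [← integral_add]
  · congr 1
    ext y
    ring
  · exact integrable_sphereLaw hd (by fun_prop)
  · exact integrable_sphereLaw hd (by fun_prop)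

/-- The weight produced by differentiating once in the direction `v`. -/
def dirWeight (d : ℕ) (v : Ed d) (w : Ed d → ℂ) (y : Ed d) : ℂ :=
  -(2 * Real.pi * Complex.I) * ⟪v, y⟫ * w y

@[fun_prop]
lemma continuous_dirWeight {d : ℕ} (v : Ed d) {w : Ed d → ℂ} (hw : Continuous w) :
    Continuous (dirWeight d v w) := by
  unfold dirWeight
  fun_prop

lemma weightedSigmaHat_dirWeight_linear {d : ℕ} (hd : 2 ≤ d) {w : Ed d → ℂ} (hw : Continuous w)
    (a b : ℝ) (u v ξ : Ed d) :
    weightedSigmaHat d (dirWeight d (a • u + b • v) w) ξ =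
      a * weightedSigmaHat d (dirWeight d u w) ξ + b * weightedSigmaHat d (dirWeight d v w) ξ := by
  rw [← weightedSigmaHat_linearCombination hd (by fun_prop) (by fun_prop)]
  congr 1
  ext y
  simp only [dirWeight, inner_add_left, real_inner_smul_left]
  push_cast
  ring

/-- Constancy of `σ̂` on a circle of radius `r`, differentiated twice. -/
lemma dirWeight_eq_of_orthogonal {d : ℕ} (hd : 2 ≤ d) {u v : Ed d} (hu : ‖u‖ = 1) (hv : ‖v‖ = 1)
    (huv : ⟪u, v⟫ = 0) {r : ℝ} (hr : r ≠ 0) :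
    weightedSigmaHat d (dirWeight d u 1) (r • u) =
      r * weightedSigmaHat d (dirWeight d v (dirWeight d v 1)) (r • u) := by
  have h1c : Continuous (1 : Ed d → ℂ) := continuous_const
  let γ : ℝ → Ed d := fun θ => (r * Real.cos θ) • u + (r * Real.sin θ) • v
  have hγ (θ : ℝ) : HasDerivAt γ ((-(r * Real.sin θ)) • u + (r * Real.cos θ) • v) θ := by
    have h1 := (((Real.hasDerivAt_cos θ).const_mul r).smul_const u).add
      (((Real.hasDerivAt_sin θ).const_mul r).smul_const v)
    exact h1.congr_deriv (by simp)
  have hnorm (θ : ℝ) : ‖γ θ‖ = ‖r • u‖ := by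
    have h2 : ‖γ θ‖ ^ 2 = ‖r • u‖ ^ 2 := by
      rw [norm_add_sq_real, norm_smul, norm_smul, norm_smul, real_inner_smul_left,
        real_inner_smul_right, huv, hu, hv]
      simp only [Real.norm_eq_abs, mul_one, sq_abs, mul_zero, add_zero]
      nlinarith [Real.sin_sq_add_cos_sq θ]
    exact (sq_eq_sq₀ (norm_nonneg _) (norm_nonneg _)).1 h2
  have hzero (θ : ℝ) : ((-(r * Real.sin θ) : ℝ) : ℂ) * weightedSigmaHat d (dirWeight d u 1) (γ θ)
      + ((r * Real.cos θ : ℝ) : ℂ) * weightedSigmaHat d (dirWeight d v 1) (γ θ) = 0 := by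
    rw [← weightedSigmaHat_dirWeight_linear hd h1c]
    have h2 := hasDerivAt_weightedSigmaHat hd h1c (hγ θ)
    have h3 : (fun s => weightedSigmaHat d 1 (γ s)) = fun _ => weightedSigmaHat d 1 (r • u) := by
      ext s
      rw [← sigmaHat_eq_weighted]
      exact sigmaHat_eq_of_norm_eq d (hnorm s)
    rw [h3] at h2
    exact h2.unique (hasDerivAt_const _ _)
  have hs : HasDerivAt (fun θ : ℝ => ((-(r * Real.sin θ) : ℝ) : ℂ))
      ((-(r * Real.cos 0) : ℝ) : ℂ) 0 :=
    (((Real.hasDerivAt_sin 0).const_mul r).neg).ofReal_comp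
  have hc : HasDerivAt (fun θ : ℝ => ((r * Real.cos θ : ℝ) : ℂ)) ((r * -Real.sin 0 : ℝ) : ℂ) 0 :=
    ((Real.hasDerivAt_cos 0).const_mul r).ofReal_comp
  have hd1 := (hs.mul (hasDerivAt_weightedSigmaHat hd
      (continuous_dirWeight u h1c) (hγ 0))).add (hc.mul
    (hasDerivAt_weightedSigmaHat hd (continuous_dirWeight v h1c) (hγ 0)))
  have hd2 := hd1.unique ((hasDerivAt_const (0 : ℝ) (0 : ℂ)).congr_of_eventuallyEq
    (Eventually.of_forall hzero))
  have hγ0 : γ 0 = r • u := by simp [γ]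
  have hlin := weightedSigmaHat_dirWeight_linear hd (continuous_dirWeight v h1c)
    (-(r * Real.sin 0)) (r * Real.cos 0) u v (r • u)
  rw [hγ0] at hd2
  change _ + (_ + _ * weightedSigmaHat d (dirWeight d _ (dirWeight d v 1)) _) = 0 at hd2
  rw [hlin] at hd2
  simp only [Real.sin_zero, Real.cos_zero, mul_one, mul_zero, neg_zero, Complex.ofReal_zero,
    zero_mul, zero_add, add_zero, Complex.ofReal_neg] at hd2
  have hr' : (r : ℂ) ≠ 0 := by exact_mod_cast hr
  apply mul_left_cancel₀ hr'
  linear_combination -hd2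

lemma sum_dirWeight_dirWeight {d : ℕ} (hd : 2 ≤ d) (ξ : Ed d) :
    ∑ i, weightedSigmaHat d (dirWeight d (EuclideanSpace.single i 1)
      (dirWeight d (EuclideanSpace.single i 1) 1)) ξ =
      -(4 * Real.pi ^ 2) * weightedSigmaHat d 1 ξ := by
  have h1c : Continuous (1 : Ed d → ℂ) := continuous_const
  simp only [weightedSigmaHat, ← integral_const_mul]
  rw [← integral_finsetSum _ fun i _ => integrable_sphereLaw hd (by fun_prop)]
  apply integral_congr_ae
  filter_upwards [ae_norm_eq_one_sphereLaw d] with y hy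
  have h2 : ∑ i, y i ^ 2 = 1 := by rw [← EuclideanSpace.real_norm_sq_eq, hy, one_pow]
  have h3 : ∑ i, (y i : ℂ) ^ 2 = 1 := by exact_mod_cast h2
  rw [← Finset.sum_mul]
  simp only [dirWeight, EuclideanSpace.inner_single_left, map_one, one_mul, Pi.one_apply, mul_one]
  congr 1
  rw [← mul_one (-(4 * (Real.pi : ℂ) ^ 2)), ← h3, Finset.mul_sum]
  refine Finset.sum_congr rfl fun i _ => ?_
  linear_combination (4 * (Real.pi : ℂ) ^ 2 * (y i : ℂ) ^ 2) * Complex.I_sq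

/-- The radial Helmholtz equation for `σ̂`. -/
lemma sigmaHat_radial_ode {d : ℕ} (hd : 2 ≤ d) (i₀ : Fin d) {r : ℝ} (hr : r ≠ 0) :
    let u : Ed d := EuclideanSpace.single i₀ 1
    ((d : ℂ) - 1) * weightedSigmaHat d (dirWeight d u 1) (r • u) =
      r * (-(4 * Real.pi ^ 2) * weightedSigmaHat d 1 (r • u)
        - weightedSigmaHat d (dirWeight d u (dirWeight d u 1)) (r • u)) := by
  intro u
  rw [← sum_dirWeight_dirWeight hd, ← Finset.add_sum_erase _ _ (Finset.mem_univ i₀),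
    add_sub_cancel_left, Finset.mul_sum]
  have h (i : Fin d) (hi : i ∈ Finset.univ.erase i₀) :
      (r : ℂ) * weightedSigmaHat d (dirWeight d (EuclideanSpace.single i 1)
        (dirWeight d (EuclideanSpace.single i 1) 1)) (r • u)
      = weightedSigmaHat d (dirWeight d u 1) (r • u) := by
    refine (dirWeight_eq_of_orthogonal hd (by simp [u]) (by simp) ?_ hr).symm
    have : i ≠ i₀ := Finset.ne_of_mem_erase hi
    simp [u, this, EuclideanSpace.inner_single_left]
  rw [Finset.sum_congr rfl h, Finset.sum_const, Finset.card_erase_of_mem (Finset.mem_univ _)]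
  simp [Nat.cast_sub (show 1 ≤ d by omega)]

/-- Energy estimate for the radial Helmholtz equation. -/
lemma exists_bound_of_radial_helmholtz (n : ℕ) {g g₁ g₂ : ℝ → ℝ}
    (hg : ∀ r, HasDerivAt g (g₁ r) r) (hg₁ : ∀ r, HasDerivAt g₁ (g₂ r) r)
    (hode : ∀ r, r ≠ 0 → n * g₁ r = r * (-(4 * Real.pi ^ 2) * g r - g₂ r)) :
    ∃ C : ℝ, ∀ r, 1 ≤ r → g r ^ 2 * r ^ n ≤ C ∧ g₁ r ^ 2 * r ^ n ≤ C := by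
  let v : ℝ → ℝ := fun r => g₁ r + (n / 2) * (g r / r)
  let E : ℝ → ℝ := fun r => r ^ n * (v r ^ 2 + 4 * Real.pi ^ 2 * g r ^ 2)
  let κ : ℝ := n ^ 2 / 4 - n / 2
  let F : ℝ → ℝ := fun r => E r * Real.exp (|κ| / r)
  have hE (r : ℝ) (hr : 0 < r) : HasDerivAt E (r ^ n * (2 * κ * (v r * g r) / r ^ 2)) r := by
    have hv : HasDerivAt v (g₂ r + (n / 2) * ((g₁ r * r - g r * 1) / r ^ 2)) r :=
      (hg₁ r).add (((hg r).div (hasDerivAt_id r) hr.ne').const_mul _)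
    have hpow : HasDerivAt (fun s : ℝ => s ^ n) (n * r ^ n / r) r := by
      refine (hasDerivAt_pow n r).congr_deriv ?_
      rcases n with _ | n
      · simp
      · rw [Nat.add_sub_cancel, pow_succ]
        field_simp
    refine (hpow.mul ((hv.pow 2).add (((hg r).pow 2).const_mul _))).congr_deriv ?_
    have h2 : g₂ r = -(4 * Real.pi ^ 2) * g r - n * g₁ r / r := by
      rw [hode r hr.ne']
      field_simp
      ring
    rw [h2]
    simp only [v, κ, Pi.add_apply, Pi.pow_apply]
    push_cast
    have hr' : r ≠ 0 := hr.ne'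
    field_simp
    ring_nf
  have hpi : 1 ≤ 4 * Real.pi ^ 2 := by nlinarith [Real.pi_gt_three]
  have hF : AntitoneOn F (Ici 1) := by
    have hderiv (r : ℝ) (hr : 0 < r) : HasDerivAt F
        (r ^ n * (2 * κ * (v r * g r) / r ^ 2) * Real.exp (|κ| / r)
          + E r * (Real.exp (|κ| / r) * (|κ| * -(r ^ 2)⁻¹))) r := by
      have := ((hasDerivAt_inv hr.ne').const_mul |κ|).exp
      exact (hE r hr).mul (by simpa [div_eq_mul_inv] using this)
    refine antitoneOn_of_hasDerivWithinAt_nonpos (convex_Ici 1)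
      (fun r hr => (hderiv r (lt_of_lt_of_le one_pos hr)).continuousAt.continuousWithinAt)
      (fun r hr => (hderiv r ?_).hasDerivWithinAt) fun r hr => ?_
    · rw [interior_Ici] at hr
      exact one_pos.trans hr
    · rw [interior_Ici] at hr
      have hr0 : 0 < r := one_pos.trans hr
      have h3 : 2 * κ * (v r * g r) ≤ |κ| * (v r ^ 2 + 4 * Real.pi ^ 2 * g r ^ 2) := by
        have ha : κ * (2 * (v r * g r)) ≤ |κ| * (v r ^ 2 + g r ^ 2) := by
          refine (le_abs_self _).trans ?_
          rw [abs_mul]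
          gcongr
          rw [abs_le]
          constructor <;> nlinarith [sq_nonneg (v r - g r), sq_nonneg (v r + g r)]
        have hb : |κ| * (v r ^ 2 + g r ^ 2) ≤ |κ| * (v r ^ 2 + 4 * Real.pi ^ 2 * g r ^ 2) := by
          gcongr
          nlinarith [sq_nonneg (g r)]
        linarith
      have h4 : r ^ n * (2 * κ * (v r * g r) / r ^ 2) * Real.exp (|κ| / r)
          + E r * (Real.exp (|κ| / r) * (|κ| * -(r ^ 2)⁻¹)) =
          r ^ n * Real.exp (|κ| / r) / r ^ 2 *
            (2 * κ * (v r * g r) - |κ| * (v r ^ 2 + 4 * Real.pi ^ 2 * g r ^ 2)) := by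
        simp only [E]
        field_simp
        ring
      rw [h4]
      exact mul_nonpos_of_nonneg_of_nonpos (by positivity) (by linarith)
  have hEF (r : ℝ) (hr : 1 ≤ r) : E r ≤ F 1 := by
    refine le_trans ?_ (hF self_mem_Ici hr hr)
    have h0 : 0 ≤ E r := by positivity
    exact le_mul_of_one_le_right h0 (Real.one_le_exp (by positivity))
  refine ⟨(2 + n ^ 2) * F 1, fun r hr => ?_⟩
  have hr0 : 0 < r := by linarith
  have h5 := hEF r hr
  have h6 : 0 ≤ r ^ n * v r ^ 2 := by positivity
  have h7 : 0 ≤ r ^ n * g r ^ 2 := by positivity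
  have h8 : r ^ n * g r ^ 2 ≤ F 1 ∧ r ^ n * v r ^ 2 ≤ F 1 := by
    simp only [E] at h5
    constructor <;> nlinarith
  have h9 : g₁ r ^ 2 ≤ 2 * v r ^ 2 + n ^ 2 * g r ^ 2 := by
    have hg1 : g₁ r = v r - (n / 2) * (g r / r) := by simp [v]
    have h10 : (g r / r) ^ 2 ≤ g r ^ 2 := by
      rw [div_pow]
      exact div_le_self (sq_nonneg _) (one_le_pow₀ hr)
    rw [hg1]
    have h11 : (n : ℝ) ^ 2 * (g r / r) ^ 2 ≤ n ^ 2 * g r ^ 2 := by gcongr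
    nlinarith [sq_nonneg (v r + (n / 2) * (g r / r)), sq_nonneg ((n : ℝ) * (g r / r))]
  have h12 : 0 ≤ (n : ℝ) ^ 2 := by positivity
  have h13 : 0 ≤ r ^ n := by positivity
  constructor
  · nlinarith
  · calc g₁ r ^ 2 * r ^ n ≤ (2 * v r ^ 2 + n ^ 2 * g r ^ 2) * r ^ n := by gcongr
      _ = 2 * (r ^ n * v r ^ 2) + n ^ 2 * (r ^ n * g r ^ 2) := by ring
      _ ≤ 2 * F 1 + n ^ 2 * F 1 := by gcongr <;> tauto
      _ = (2 + n ^ 2) * F 1 := by ring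

/-- Decay of `σ̂` and of its radial derivative. -/
lemma exists_sigmaHat_decay {d : ℕ} (hd : 2 ≤ d) :
    ∃ C : ℝ, 0 < C ∧ ∀ η : Ed d, 1 ≤ ‖η‖ →
      ‖sigmaHat d η‖ ^ 2 * ‖η‖ ^ (d - 1) ≤ C ∧
      ‖fderiv ℝ (sigmaHat d) η η‖ ^ 2 * ‖η‖ ^ (d - 1) ≤ C * ‖η‖ ^ 2 := by
  have h1c : Continuous (1 : Ed d → ℂ) := continuous_const
  let i₀ : Fin d := ⟨0, by omega⟩
  let u : Ed d := EuclideanSpace.single i₀ 1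
  have hu : ‖u‖ = 1 := by simp [u]
  let g : ℝ → ℂ := fun r => weightedSigmaHat d 1 (r • u)
  let g₁ : ℝ → ℂ := fun r => weightedSigmaHat d (dirWeight d u 1) (r • u)
  let g₂ : ℝ → ℂ := fun r => weightedSigmaHat d (dirWeight d u (dirWeight d u 1)) (r • u)
  have hray (r : ℝ) : HasDerivAt (fun s : ℝ => s • u) u r := by
    simpa using (hasDerivAt_id r).smul_const u
  have hg (r : ℝ) : HasDerivAt g (g₁ r) r := hasDerivAt_weightedSigmaHat hd h1c (hray r)
  have hg₁ (r : ℝ) : HasDerivAt g₁ (g₂ r) r :=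
    hasDerivAt_weightedSigmaHat hd (continuous_dirWeight u h1c) (hray r)
  have hode (r : ℝ) (hr : r ≠ 0) :
      (((d - 1 : ℕ) : ℝ) : ℂ) * g₁ r = r * (((-(4 * Real.pi ^ 2) : ℝ) : ℂ) * g r - g₂ r) := by
    have := sigmaHat_radial_ode hd i₀ hr
    push_cast [Nat.cast_sub (show 1 ≤ d by omega)]
    exact this
  have hode_re (r : ℝ) (hr : r ≠ 0) :
      (d - 1 : ℕ) * (g₁ r).re = r * (-(4 * Real.pi ^ 2) * (g r).re - (g₂ r).re) := by
    have h := congrArg Complex.re (hode r hr)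
    rwa [Complex.re_ofReal_mul, Complex.re_ofReal_mul, Complex.sub_re, Complex.re_ofReal_mul] at h
  have hode_im (r : ℝ) (hr : r ≠ 0) :
      (d - 1 : ℕ) * (g₁ r).im = r * (-(4 * Real.pi ^ 2) * (g r).im - (g₂ r).im) := by
    have h := congrArg Complex.im (hode r hr)
    rwa [Complex.im_ofReal_mul, Complex.im_ofReal_mul, Complex.sub_im, Complex.im_ofReal_mul] at h
  obtain ⟨C₁, hC₁⟩ := exists_bound_of_radial_helmholtz (d - 1)
    (g := fun r => (g r).re) (g₁ := fun r => (g₁ r).re) (g₂ := fun r => (g₂ r).re)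
    (fun r => Complex.reCLM.hasFDerivAt.comp_hasDerivAt r (hg r))
    (fun r => Complex.reCLM.hasFDerivAt.comp_hasDerivAt r (hg₁ r))
    hode_re
  obtain ⟨C₂, hC₂⟩ := exists_bound_of_radial_helmholtz (d - 1)
    (g := fun r => (g r).im) (g₁ := fun r => (g₁ r).im) (g₂ := fun r => (g₂ r).im)
    (fun r => Complex.imCLM.hasFDerivAt.comp_hasDerivAt r (hg r))
    (fun r => Complex.imCLM.hasFDerivAt.comp_hasDerivAt r (hg₁ r))
    hode_im
  have hsq (z : ℂ) : ‖z‖ ^ 2 = z.re ^ 2 + z.im ^ 2 := by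
    rw [← Complex.normSq_eq_norm_sq, Complex.normSq_apply]
    ring
  refine ⟨max 1 (C₁ + C₂), by positivity, fun η hη => ?_⟩
  set r := ‖η‖ with hr
  have hr0 : 0 < r := by linarith
  have hval : ∀ s : ℝ, sigmaHat d (s • (r⁻¹ • η)) = g s := fun s => by
    rw [show g s = sigmaHat d (s • u) by rw [sigmaHat_eq_weighted]]
    apply sigmaHat_eq_of_norm_eq
    rw [norm_smul, norm_smul, norm_smul, hu, norm_inv, norm_norm, inv_mul_cancel₀ hr0.ne']
  have hη' : r • (r⁻¹ • η) = η := smul_inv_smul₀ hr0.ne' η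
  have hval0 : sigmaHat d η = g r := by rw [← hval r, hη']
  have hder : fderiv ℝ (sigmaHat d) η η = r * g₁ r := by
    have hdiff : DifferentiableAt ℝ (sigmaHat d) (r • (r⁻¹ • η)) :=
      (contDiff_sigmaHat hd).differentiable (by simp) _
    have h1 : HasDerivAt (fun s : ℝ => s • (r⁻¹ • η)) (r⁻¹ • η) r := by
      simpa using (hasDerivAt_id r).smul_const (r⁻¹ • η)
    have h2 := hdiff.hasFDerivAt.comp_hasDerivAt r h1
    rw [show sigmaHat d ∘ (fun s : ℝ => s • (r⁻¹ • η)) = g from funext hval, hη', map_smul] at h2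
    rw [← h2.unique (hg r), Complex.real_smul, ← mul_assoc]
    simp [hr0.ne']
  obtain ⟨a₁, b₁⟩ := hC₁ r hη
  obtain ⟨a₂, b₂⟩ := hC₂ r hη
  have hmax := le_max_right 1 (C₁ + C₂)
  constructor
  · rw [hval0, hsq]
    nlinarith
  · rw [hder, norm_mul, mul_pow, Complex.norm_real, norm_norm, hsq]
    have : ((g₁ r).re ^ 2 + (g₁ r).im ^ 2) * r ^ (d - 1) ≤ max 1 (C₁ + C₂) := by nlinarith
    nlinarith [sq_nonneg r]

lemma betaJ_eq (d : ℕ) (β0 : Ed d → ℝ) (j : ℕ) (ξ : Ed d) :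
    betaJ d β0 j ξ = betaJ d β0 0 (((2 : ℝ) ^ j)⁻¹ • ξ) := by
  simp only [betaJ, smul_smul, zpow_neg, zpow_natCast, zpow_sub₀ (two_ne_zero' ℝ), Nat.cast_zero,
    zpow_zero, zpow_one, one_mul, div_one, neg_zero]
  rw [div_eq_mul_inv]

section Localized

variable {d : ℕ} {β0 : Ed d → ℝ}

lemma contDiff_betaJ (hβ0 : IsAdmissibleBump d β0) (j : ℕ) :
    ContDiff ℝ (⊤ : ℕ∞) (betaJ d β0 j) :=
  (hβ0.1.comp (contDiff_const_smul _)).sub (hβ0.1.comp (contDiff_const_smul _))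

lemma betaJ_zero_eq_zero (hβ0 : IsAdmissibleBump d β0) {ξ : Ed d}
    (h : ‖ξ‖ ∉ Icc (1 / 2 : ℝ) 2) : betaJ d β0 0 ξ = 0 := by
  obtain ⟨-, -, -, h1, h2⟩ := hβ0
  have hn : ‖(2 : ℝ) • ξ‖ = 2 * ‖ξ‖ := by rw [norm_smul]; simp
  simp only [betaJ, Nat.cast_zero, neg_zero, zpow_zero, one_smul, sub_zero, zpow_one]
  rw [mem_Icc, not_and_or, not_le, not_le] at h
  rcases h with h | h
  · rw [h1 ξ (by linarith), h1 _ (by rw [hn]; linarith), sub_self]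
  · rw [h2 ξ (by linarith), h2 _ (by rw [hn]; linarith), sub_self]

lemma betaJ_eq_zero (hβ0 : IsAdmissibleBump d β0) {j : ℕ} {ξ : Ed d}
    (h : ‖ξ‖ ∉ Icc ((2 : ℝ) ^ j / 2) (2 * 2 ^ j)) : betaJ d β0 j ξ = 0 := by
  rw [betaJ_eq]
  apply betaJ_zero_eq_zero hβ0
  contrapose! h
  have h2 : (0 : ℝ) < 2 ^ j := by positivity
  rw [norm_smul, norm_inv, Real.norm_of_nonneg h2.le, ← div_eq_inv_mul, mem_Icc, le_div_iff₀ h2,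
    div_le_iff₀ h2] at h
  exact ⟨by linarith [h.1], h.2⟩

lemma hasCompactSupport_betaJ (hβ0 : IsAdmissibleBump d β0) (j : ℕ) :
    HasCompactSupport (betaJ d β0 j) := by
  refine HasCompactSupport.intro (isCompact_closedBall (0 : Ed d) (2 * 2 ^ j)) fun ξ hξ => ?_
  refine betaJ_eq_zero hβ0 fun h => hξ ?_
  rw [mem_closedBall_zero_iff]
  exact h.2

/-- The localized multiplier `σ̂ β_j`. -/
def localMult (d : ℕ) (β0 : Ed d → ℝ) (j : ℕ) (η : Ed d) : ℂ :=
  sigmaHat d η * (betaJ d β0 j η : ℂ)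

lemma contDiff_localMult (hd : 2 ≤ d) (hβ0 : IsAdmissibleBump d β0) (j : ℕ) :
    ContDiff ℝ (⊤ : ℕ∞) (localMult d β0 j) :=
  (contDiff_sigmaHat hd).mul (Complex.ofRealCLM.contDiff.comp (contDiff_betaJ hβ0 j))

lemma hasCompactSupport_localMult (hβ0 : IsAdmissibleBump d β0) (j : ℕ) :
    HasCompactSupport (localMult d β0 j) :=
  HasCompactSupport.mul_left ((hasCompactSupport_betaJ hβ0 j).comp_left Complex.ofReal_zero)

lemma exists_localMult_bound (hd : 2 ≤ d) (hβ0 : IsAdmissibleBump d β0) :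
    ∃ C : ℝ, 0 < C ∧ ∀ j : ℕ, 1 ≤ j → ∀ η : Ed d,
      ‖localMult d β0 j η‖ ^ 2 * ((2 : ℝ) ^ j) ^ (d - 1) ≤ C ∧
      ‖fderiv ℝ (localMult d β0 j) η η‖ ^ 2 * ((2 : ℝ) ^ j) ^ (d - 1) ≤ C * ((2 : ℝ) ^ j) ^ 2 := by
  obtain ⟨C, hC, hdecay⟩ := exists_sigmaHat_decay hd
  have hb := contDiff_betaJ hβ0 0
  obtain ⟨B, hB⟩ := (hasCompactSupport_betaJ hβ0 0).exists_bound_of_continuous hb.continuous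
  obtain ⟨B', hB'⟩ : ∃ B', ∀ ξ, ‖fderiv ℝ (betaJ d β0 0) ξ ξ‖ ≤ B' := by
    refine HasCompactSupport.exists_bound_of_continuous ?_
      ((hb.continuous_fderiv (by simp)).clm_apply continuous_id)
    refine ((hasCompactSupport_betaJ hβ0 0).fderiv (𝕜 := ℝ)).mono fun ξ hξ h => hξ ?_
    simp only [h, _root_.zero_apply]
  refine ⟨2 ^ (d - 1) * C * (8 * B ^ 2 + 2 * B' ^ 2 + 1), by positivity, fun j hj η => ?_⟩
  have h2 : (0 : ℝ) < 2 ^ j := by positivity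
  have h21 : (2 : ℝ) ≤ 2 ^ j := by simpa using pow_le_pow_right₀ (one_le_two (α := ℝ)) hj
  by_cases hη : ‖η‖ ∈ Icc ((2 : ℝ) ^ j / 2) (2 * 2 ^ j)
  · have hη1 : 1 ≤ ‖η‖ := by linarith [hη.1]
    obtain ⟨hs, hs'⟩ := hdecay η hη1
    have hpow : ((2 : ℝ) ^ j) ^ (d - 1) ≤ 2 ^ (d - 1) * ‖η‖ ^ (d - 1) := by
      rw [← mul_pow]
      exact pow_le_pow_left₀ h2.le (by linarith [hη.1]) _
    have hbj : |betaJ d β0 j η| ≤ B := by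
      rw [betaJ_eq]
      exact hB _
    have hbj2 : betaJ d β0 j η ^ 2 ≤ B ^ 2 := sq_le_sq' (by linarith [neg_abs_le (betaJ d β0 j η)])
      (by linarith [le_abs_self (betaJ d β0 j η)])
    have hS : ‖sigmaHat d η‖ ^ 2 * ((2 : ℝ) ^ j) ^ (d - 1) ≤ 2 ^ (d - 1) * C :=
      calc _ ≤ ‖sigmaHat d η‖ ^ 2 * (2 ^ (d - 1) * ‖η‖ ^ (d - 1)) := by gcongr
        _ = 2 ^ (d - 1) * (‖sigmaHat d η‖ ^ 2 * ‖η‖ ^ (d - 1)) := by ring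
        _ ≤ _ := by gcongr
    have hS' : ‖fderiv ℝ (sigmaHat d) η η‖ ^ 2 * ((2 : ℝ) ^ j) ^ (d - 1) ≤
        2 ^ (d - 1) * C * (4 * (2 ^ j) ^ 2) :=
      calc _ ≤ ‖fderiv ℝ (sigmaHat d) η η‖ ^ 2 * (2 ^ (d - 1) * ‖η‖ ^ (d - 1)) := by gcongr
        _ = 2 ^ (d - 1) * (‖fderiv ℝ (sigmaHat d) η η‖ ^ 2 * ‖η‖ ^ (d - 1)) := by ring
        _ ≤ 2 ^ (d - 1) * (C * ‖η‖ ^ 2) := by gcongr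
        _ ≤ 2 ^ (d - 1) * (C * (2 * 2 ^ j) ^ 2) := by gcongr; exact hη.2
        _ = _ := by ring
    have hderiv : fderiv ℝ (localMult d β0 j) η η =
        fderiv ℝ (sigmaHat d) η η * (betaJ d β0 j η : ℂ) +
        sigmaHat d η * ((fderiv ℝ (betaJ d β0 0) (((2 : ℝ) ^ j)⁻¹ • η) (((2 : ℝ) ^ j)⁻¹ • η) : ℝ)
          : ℂ) := by
      have e1 : HasFDerivAt (sigmaHat d) (fderiv ℝ (sigmaHat d) η) η :=
        ((contDiff_sigmaHat hd).differentiable (by simp) η).hasFDerivAt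
      have e2 : HasFDerivAt (betaJ d β0 0) (fderiv ℝ (betaJ d β0 0) (((2 : ℝ) ^ j)⁻¹ • η))
          (((2 : ℝ) ^ j)⁻¹ • η) := (hb.differentiable (by simp) _).hasFDerivAt
      have e3 : HasFDerivAt (fun x : Ed d => ((2 : ℝ) ^ j)⁻¹ • x)
          (((2 : ℝ) ^ j)⁻¹ • ContinuousLinearMap.id ℝ (Ed d)) η :=
        (((2 : ℝ) ^ j)⁻¹ • ContinuousLinearMap.id ℝ (Ed d)).hasFDerivAt
      have e4 : HasFDerivAt (fun x => (betaJ d β0 j x : ℂ)) _ η :=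
        (Complex.ofRealCLM.hasFDerivAt.comp η (e2.comp η e3)).congr_of_eventuallyEq
          (Eventually.of_forall fun x => by
            simp only [Function.comp, Complex.ofRealCLM_apply, ← betaJ_eq])
      rw [show localMult d β0 j = sigmaHat d * fun x => (betaJ d β0 j x : ℂ) from rfl,
        (e1.mul e4).fderiv]
      simp [mul_comm, add_comm]
    constructor
    · rw [localMult, norm_mul, mul_pow, Complex.norm_real, Real.norm_eq_abs, sq_abs]
      calc _ = (‖sigmaHat d η‖ ^ 2 * ((2 : ℝ) ^ j) ^ (d - 1)) * betaJ d β0 j η ^ 2 := by ring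
        _ ≤ (2 ^ (d - 1) * C) * B ^ 2 := by gcongr
        _ ≤ _ := by
          gcongr
          nlinarith [sq_nonneg B, sq_nonneg B']
    · set D := fderiv ℝ (betaJ d β0 0) (((2 : ℝ) ^ j)⁻¹ • η) (((2 : ℝ) ^ j)⁻¹ • η) with hD
      have hDb : D ^ 2 ≤ B' ^ 2 := by
        have : |D| ≤ B' := hB' _
        exact sq_le_sq' (by linarith [neg_abs_le D]) (by linarith [le_abs_self D])
      have hn : ‖fderiv ℝ (localMult d β0 j) η η‖ ^ 2 ≤
          2 * (‖fderiv ℝ (sigmaHat d) η η‖ ^ 2 * betaJ d β0 j η ^ 2) +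
          2 * (‖sigmaHat d η‖ ^ 2 * D ^ 2) := by
        rw [hderiv]
        have e := norm_add_le (fderiv ℝ (sigmaHat d) η η * (betaJ d β0 j η : ℂ))
          (sigmaHat d η * (D : ℂ))
        rw [norm_mul, norm_mul, Complex.norm_real, Complex.norm_real, Real.norm_eq_abs,
          Real.norm_eq_abs] at e
        calc _ ≤ (‖fderiv ℝ (sigmaHat d) η η‖ * |betaJ d β0 j η| + ‖sigmaHat d η‖ * |D|) ^ 2 := by
              gcongr
          _ ≤ 2 * ((‖fderiv ℝ (sigmaHat d) η η‖ * |betaJ d β0 j η|) ^ 2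
              + (‖sigmaHat d η‖ * |D|) ^ 2) := add_sq_le
          _ = _ := by
            rw [mul_pow, mul_pow, sq_abs, sq_abs]
            ring
      have hone : 1 ≤ ((2 : ℝ) ^ j) ^ 2 := one_le_pow₀ (by linarith)
      calc _ ≤ (2 * (‖fderiv ℝ (sigmaHat d) η η‖ ^ 2 * betaJ d β0 j η ^ 2) +
            2 * (‖sigmaHat d η‖ ^ 2 * D ^ 2)) * ((2 : ℝ) ^ j) ^ (d - 1) := by gcongr
        _ = 2 * (‖fderiv ℝ (sigmaHat d) η η‖ ^ 2 * ((2 : ℝ) ^ j) ^ (d - 1)) * betaJ d β0 j η ^ 2 +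
            2 * (‖sigmaHat d η‖ ^ 2 * ((2 : ℝ) ^ j) ^ (d - 1)) * D ^ 2 := by ring
        _ ≤ 2 * (2 ^ (d - 1) * C * (4 * (2 ^ j) ^ 2)) * B ^ 2 +
            2 * (2 ^ (d - 1) * C) * B' ^ 2 := by gcongr
        _ ≤ 2 * (2 ^ (d - 1) * C * (4 * (2 ^ j) ^ 2)) * B ^ 2 +
            2 * (2 ^ (d - 1) * C) * B' ^ 2 * (2 ^ j) ^ 2 + 2 ^ (d - 1) * C * (2 ^ j) ^ 2 := by
          have e1 := le_mul_of_one_le_right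
            (show 0 ≤ 2 * (2 ^ (d - 1) * C) * B' ^ 2 by positivity) hone
          have e2 : 0 ≤ 2 ^ (d - 1) * C * ((2 : ℝ) ^ j) ^ 2 := by positivity
          linarith
        _ = _ := by ring
  · have hev : localMult d β0 j =ᶠ[𝓝 η] fun _ => 0 := by
      have : ∀ᶠ x in 𝓝 η, ‖x‖ ∉ Icc ((2 : ℝ) ^ j / 2) (2 * 2 ^ j) :=
        (isClosed_Icc.preimage continuous_norm).isOpen_compl.mem_nhds hη
      filter_upwards [this] with x hx
      rw [localMult, betaJ_eq_zero hβ0 hx, Complex.ofReal_zero, mul_zero]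
    rw [hev.fderiv_eq, hev.eq_of_nhds]
    simp
    constructor <;> positivity

end Localized

section Multipliers
open FourierTransform

variable {d : ℕ}

/-- The Fourier multiplier operator with symbol `h`. -/
def multOp (d : ℕ) (h : Ed d → ℂ) (f : Ed d → ℂ) (x : Ed d) : ℂ :=
  ∫ ξ, eChar (2 * Real.pi * ⟪ξ, x⟫) * (h ξ * fourierInt d f ξ)

lemma fourierInt_eq (f : SchwartzMap (Ed d) ℂ) (ξ : Ed d) : fourierInt d f ξ = 𝓕 f ξ := by
  rw [SchwartzMap.fourier_coe, Real.fourier_eq, fourierInt]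
  congr 1
  ext x
  rw [Circle.smul_def, fourierChar_eq_eChar, smul_eq_mul, real_inner_comm]
  ring_nf

lemma exists_schwartz_multOp {h : Ed d → ℂ} (hc : HasCompactSupport h)
    (hs : ContDiff ℝ (⊤ : ℕ∞) h) (f : SchwartzMap (Ed d) ℂ) :
    ∃ g : SchwartzMap (Ed d) ℂ, ⇑g = multOp d h f ∧ ∀ ξ, 𝓕 g ξ = h ξ * 𝓕 f ξ := by
  have hc' : HasCompactSupport (fun ξ => h ξ * 𝓕 f ξ) := hc.mul_right
  have hs' : ContDiff ℝ (⊤ : ℕ∞) (fun ξ => h ξ * 𝓕 f ξ) := hs.mul ((𝓕 f).smooth _)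
  refine ⟨𝓕⁻ (hc'.toSchwartzMap hs'), ?_, fun ξ => ?_⟩
  · ext x
    rw [SchwartzMap.fourierInv_coe, Real.fourierInv_eq, multOp]
    congr 1
    ext ξ
    rw [Circle.smul_def, fourierChar_eq_eChar, smul_eq_mul, fourierInt_eq]
    rfl
  · rw [FourierTransform.fourier_fourierInv_eq]
    rfl

lemma lintegral_enorm_sq_eq (g : SchwartzMap (Ed d) ℂ) :
    ∫⁻ x, ‖g x‖ₑ ^ 2 = ENNReal.ofReal (∫ x, ‖g x‖ ^ 2) := by
  have hi : Integrable (fun x => ‖g x‖ ^ 2) := by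
    have := (g.memLp 2 volume).integrable_norm_pow (by norm_num)
    simpa using this
  rw [ofReal_integral_eq_lintegral_ofReal hi (Eventually.of_forall fun x => by positivity)]
  congr 1
  ext x
  rw [ENNReal.ofReal_pow (norm_nonneg _), ofReal_norm]

lemma lintegral_enorm_sq_multOp_le {h : Ed d → ℂ} (hc : HasCompactSupport h)
    (hs : ContDiff ℝ (⊤ : ℕ∞) h) {M : ℝ} (hM : ∀ ξ, ‖h ξ‖ ^ 2 ≤ M)
    (f : SchwartzMap (Ed d) ℂ) :
    ∫⁻ x, ‖multOp d h f x‖ₑ ^ 2 ≤ ENNReal.ofReal M * ∫⁻ x, ‖f x‖ₑ ^ 2 := by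
  obtain ⟨g, hg, hgh⟩ := exists_schwartz_multOp hc hs f
  have hM0 : 0 ≤ M := (sq_nonneg _).trans (hM 0)
  have hi (g : SchwartzMap (Ed d) ℂ) : Integrable (fun x => ‖g x‖ ^ 2) := by
    have := (g.memLp 2 volume).integrable_norm_pow (by norm_num)
    simpa using this
  rw [← hg, lintegral_enorm_sq_eq, lintegral_enorm_sq_eq, ← ENNReal.ofReal_mul hM0]
  apply ENNReal.ofReal_le_ofReal
  rw [← SchwartzMap.integral_norm_sq_fourier g, ← SchwartzMap.integral_norm_sq_fourier f,
    ← integral_const_mul]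
  refine integral_mono (hi _) ((hi _).const_mul _) fun ξ => ?_
  simp only [hgh, norm_mul, mul_pow]
  gcongr
  exact hM ξ

lemma Aj_eq_multOp (β0 : Ed d → ℝ) (j : ℕ) (t : ℝ) (f : Ed d → ℂ) :
    Aj d β0 j t f = multOp d (fun ξ => localMult d β0 j (t • ξ)) f := rfl

/-- The symbol of the derivative of `A_t^j` in `t`. -/
def radialDerivMult (d : ℕ) (β0 : Ed d → ℝ) (j : ℕ) (t : ℝ) (ξ : Ed d) : ℂ :=
  fderiv ℝ (localMult d β0 j) (t • ξ) ξ

variable {β0 : Ed d → ℝ}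

lemma hasCompactSupport_comp_smul {E : Type*} [Zero E] {h : Ed d → E} (hc : HasCompactSupport h)
    {t : ℝ} (ht : t ≠ 0) :
    HasCompactSupport (fun ξ => h (t • ξ)) :=
  hc.comp_homeomorph (Homeomorph.smulOfNeZero t ht)

lemma contDiff_radialDerivMult (hd : 2 ≤ d) (hβ0 : IsAdmissibleBump d β0) (j : ℕ) (t : ℝ) :
    ContDiff ℝ (⊤ : ℕ∞) (radialDerivMult d β0 j t) := by
  have := (contDiff_localMult hd hβ0 j).fderiv_right (m := (⊤ : ℕ∞)) (by simp)
  exact (this.comp (contDiff_const_smul t)).clm_apply contDiff_id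

lemma hasCompactSupport_radialDerivMult (hβ0 : IsAdmissibleBump d β0) (j : ℕ)
    {t : ℝ} (ht : t ≠ 0) : HasCompactSupport (radialDerivMult d β0 j t) := by
  have h := hasCompactSupport_comp_smul ((hasCompactSupport_localMult hβ0 j).fderiv ℝ) ht
  refine h.mono fun ξ hξ h0 => hξ ?_
  simp only [radialDerivMult]
  simp only at h0
  rw [h0]
  rfl

lemma hasDerivAt_localMult_smul (hd : 2 ≤ d) (hβ0 : IsAdmissibleBump d β0) (j : ℕ) (t : ℝ)
    (ξ : Ed d) :
    HasDerivAt (fun s : ℝ => localMult d β0 j (s • ξ)) (radialDerivMult d β0 j t ξ) t := by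
  have h1 : HasFDerivAt (localMult d β0 j) (fderiv ℝ (localMult d β0 j) (t • ξ)) (t • ξ) :=
    ((contDiff_localMult hd hβ0 j).differentiable (by simp) _).hasFDerivAt
  have h2 : HasDerivAt (fun s : ℝ => s • ξ) ξ t := by
    simpa using (hasDerivAt_id t).smul_const ξ
  exact h1.comp_hasDerivAt t h2

lemma continuous_radialDerivMult (hd : 2 ≤ d) (hβ0 : IsAdmissibleBump d β0) (j : ℕ) :
    Continuous (fun q : ℝ × Ed d => radialDerivMult d β0 j q.1 q.2) := by
  have := ((contDiff_localMult hd hβ0 j).continuous_fderiv (by simp))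
  unfold radialDerivMult
  fun_prop

lemma exists_radialDerivMult_le (hd : 2 ≤ d) (hβ0 : IsAdmissibleBump d β0) (j : ℕ) :
    ∃ K, ∀ t ξ, ‖radialDerivMult d β0 j t ξ‖ ≤ K * ‖ξ‖ := by
  obtain ⟨K, hK⟩ := ((contDiff_localMult hd hβ0 j).continuous_fderiv
    (by simp)).bounded_above_of_compact_support ((hasCompactSupport_localMult hβ0 j).fderiv ℝ)
  exact ⟨K, fun t ξ => ((fderiv ℝ (localMult d β0 j) (t • ξ)).le_opNorm ξ).trans
    (mul_le_mul_of_nonneg_right (hK _) (norm_nonneg _))⟩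

lemma integrable_norm_mul_fourier (f : SchwartzMap (Ed d) ℂ) :
    Integrable (fun ξ : Ed d => ‖ξ‖ * ‖(𝓕 f : SchwartzMap (Ed d) ℂ) ξ‖) := by
  simpa using (𝓕 f : SchwartzMap (Ed d) ℂ).integrable_pow_mul volume 1

/-- The integrand of `B_t f(x)` is jointly integrable in `(t, ξ)` over bounded `t`-intervals. -/
lemma integrable_prod_radialDerivMult (hd : 2 ≤ d) (hβ0 : IsAdmissibleBump d β0) (j : ℕ)
    (a b : ℝ) (f : SchwartzMap (Ed d) ℂ) (x : Ed d) :
    Integrable (fun q : ℝ × Ed d => eChar (2 * Real.pi * ⟪q.2, x⟫) *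
      (radialDerivMult d β0 j q.1 q.2 * 𝓕 f q.2)) ((volume.restrict (uIoc a b)).prod volume) := by
  obtain ⟨K, hK⟩ := exists_radialDerivMult_le hd hβ0 j
  have h1 : Integrable (fun _ : ℝ => (1 : ℝ)) (volume.restrict (uIoc a b)) := by
    have : IsFiniteMeasure (volume.restrict (uIoc a b)) := ⟨by simp [uIoc]⟩
    exact integrable_const _
  have h2 := h1.mul_prod ((integrable_norm_mul_fourier f).const_mul K)
  have hc := continuous_radialDerivMult hd hβ0 j
  have hf := (𝓕 f).continuous
  refine h2.mono' (Continuous.aestronglyMeasurable (by fun_prop))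
    (Eventually.of_forall fun q => ?_)
  rw [norm_mul, norm_eChar, norm_mul, one_mul, one_mul]
  calc _ ≤ (K * ‖q.2‖) * ‖𝓕 f q.2‖ := by gcongr; exact hK _ _
    _ = _ := by ring

lemma multOp_integrable {h : Ed d → ℂ} (hc : HasCompactSupport h) (hs : Continuous h)
    (f : SchwartzMap (Ed d) ℂ) (x : Ed d) :
    Integrable (fun ξ => eChar (2 * Real.pi * ⟪ξ, x⟫) * (h ξ * 𝓕 f ξ)) := by
  have hf := (𝓕 f).continuous
  refine Continuous.integrable_of_hasCompactSupport (by fun_prop) ?_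
  exact (hc.mul_right).mul_left

lemma Aj_sub_Aj (hd : 2 ≤ d) (hβ0 : IsAdmissibleBump d β0) (j : ℕ) {a t : ℝ} (ha : 0 < a)
    (hat : a ≤ t) (f : SchwartzMap (Ed d) ℂ) (x : Ed d) :
    Aj d β0 j t f x - Aj d β0 j a f x = ∫ u in a..t, multOp d (radialDerivMult d β0 j u) f x := by
  have hI {s : ℝ} (hs : 0 < s) := multOp_integrable
    (hasCompactSupport_comp_smul (hasCompactSupport_localMult hβ0 j) hs.ne')
    ((contDiff_localMult hd hβ0 j).continuous.comp (continuous_const_smul s)) f x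
  rw [Aj_eq_multOp, Aj_eq_multOp, multOp, multOp]
  simp_rw [multOp, fourierInt_eq]
  rw [← integral_sub (hI (ha.trans_le hat)) (hI ha),
    intervalIntegral_integral_swap (integrable_prod_radialDerivMult hd hβ0 j a t f x)]
  congr 1
  ext ξ
  have h := intervalIntegral.integral_eq_sub_of_hasDerivAt (a := a) (b := t)
    (fun u _ => hasDerivAt_localMult_smul hd hβ0 j u ξ)
    (((continuous_radialDerivMult hd hβ0 j).comp
      (by fun_prop : Continuous fun u : ℝ => (u, ξ))).intervalIntegrable _ _)
  rw [intervalIntegral.integral_const_mul, intervalIntegral.integral_mul_const]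
  rw [h]
  ring

end Multipliers

section MaximalL2

variable {d : ℕ} {β0 : Ed d → ℝ}

lemma measurable_multOp_radialDerivMult (hd : 2 ≤ d) (hβ0 : IsAdmissibleBump d β0) (j : ℕ)
    (f : SchwartzMap (Ed d) ℂ) :
    Measurable (fun q : ℝ × Ed d => multOp d (radialDerivMult d β0 j q.1) f q.2) := by
  have hc : Continuous (fun z : (ℝ × Ed d) × Ed d => radialDerivMult d β0 j z.1.1 z.2) :=
    (continuous_radialDerivMult hd hβ0 j).comp
      (by fun_prop : Continuous fun z : (ℝ × Ed d) × Ed d => (z.1.1, z.2))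
  have hf : Continuous (fourierInt d f) := by
    rw [funext (fourierInt_eq f)]
    exact (FourierTransform.fourier f).continuous
  have h : Continuous (fun z : (ℝ × Ed d) × Ed d => eChar (2 * Real.pi * ⟪z.2, z.1.2⟫) *
      (radialDerivMult d β0 j z.1.1 z.2 * fourierInt d f z.2)) := by fun_prop
  exact (h.stronglyMeasurable.integral_prod_right').measurable

lemma supAj_Icc_le (hd : 2 ≤ d) (hβ0 : IsAdmissibleBump d β0) (j : ℕ) {a b : ℝ} (ha : 0 < a)
    (f : SchwartzMap (Ed d) ℂ) (x : Ed d) :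
    supAj d β0 j (Icc a b) f x ≤ ‖Aj d β0 j a f x‖ₑ +
      ∫⁻ u in Ioc a b, ‖multOp d (radialDerivMult d β0 j u) f x‖ₑ := by
  refine iSup₂_le fun t ht => ?_
  have h := Aj_sub_Aj hd hβ0 j ha ht.1 f x
  rw [← enorm_eq_nnnorm, eq_add_of_sub_eq' h]
  refine (enorm_add_le _ _).trans (add_le_add_right ?_ _)
  rw [intervalIntegral.integral_of_le ht.1]
  exact (enorm_integral_le_lintegral_enorm _).trans
    (lintegral_mono_set (Ioc_subset_Ioc_right ht.2))

lemma lintegral_sq_le_measure_mul {α : Type*} [MeasurableSpace α] (μ : Measure α) {g : α → ℝ≥0∞}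
    (hg : AEMeasurable g μ) : (∫⁻ u, g u ∂μ) ^ 2 ≤ μ univ * ∫⁻ u, g u ^ 2 ∂μ := by
  have h := ENNReal.lintegral_mul_le_Lp_mul_Lq μ Real.HolderConjugate.two_two
    (aemeasurable_const (b := (1 : ℝ≥0∞))) hg
  simp only [Pi.mul_apply, one_mul, lintegral_const, ENNReal.rpow_ofNat, one_pow] at h
  calc _ ≤ ((μ univ) ^ (1 / 2 : ℝ) * (∫⁻ u, g u ^ 2 ∂μ) ^ (1 / 2 : ℝ)) ^ 2 := by gcongr
    _ = _ := by
      rw [mul_pow, ← ENNReal.rpow_natCast, ← ENNReal.rpow_natCast, ← ENNReal.rpow_mul,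
        ← ENNReal.rpow_mul]
      norm_num

lemma exists_lintegral_supAj_sq_le (hd : 2 ≤ d) (hβ0 : IsAdmissibleBump d β0) :
    ∃ C : ℝ, 0 < C ∧ ∀ (k : ℤ) (j : ℕ) (a b : ℝ), 1 ≤ j → (2 : ℝ) ^ k ≤ a →
      b - a ≤ (2 : ℝ) ^ (k - (j : ℤ)) → ∀ f : SchwartzMap (Ed d) ℂ,
      ∫⁻ x, supAj d β0 j (Icc a b) f x ^ 2 ≤
        ENNReal.ofReal (C * (((2 : ℝ) ^ j) ^ (d - 1))⁻¹) * ∫⁻ x, ‖f x‖ₑ ^ 2 := by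
  obtain ⟨C, hC, hb⟩ := exists_localMult_bound hd hβ0
  refine ⟨4 * C, by positivity, fun k j a b hj hka hab f => ?_⟩
  have hk : (0 : ℝ) < 2 ^ k := by positivity
  have ha : 0 < a := hk.trans_le hka
  set M : ℝ := C * (((2 : ℝ) ^ j) ^ (d - 1))⁻¹ with hM
  have hM0 : 0 ≤ M := by positivity
  set F := ∫⁻ x, ‖f x‖ₑ ^ 2
  set δ : ℝ := (2 : ℝ) ^ (k - (j : ℤ)) with hδ
  have hδ0 : 0 < δ := by positivity
  have hA : ∫⁻ x, ‖Aj d β0 j a f x‖ₑ ^ 2 ≤ ENNReal.ofReal M * F := by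
    rw [Aj_eq_multOp]
    refine lintegral_enorm_sq_multOp_le
      (hasCompactSupport_comp_smul (hasCompactSupport_localMult hβ0 j) ha.ne')
      ((contDiff_localMult hd hβ0 j).comp (contDiff_const_smul a)) (fun ξ => ?_) f
    rw [hM, ← div_eq_mul_inv, le_div_iff₀ (by positivity)]
    exact (hb j hj _).1
  have hB (u : ℝ) (hu : u ∈ Ioc a b) : ∫⁻ x, ‖multOp d (radialDerivMult d β0 j u) f x‖ₑ ^ 2 ≤
      ENNReal.ofReal (M * (δ ^ 2)⁻¹) * F := by
    have hu0 : 0 < u := ha.trans hu.1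
    refine lintegral_enorm_sq_multOp_le (hasCompactSupport_radialDerivMult hβ0 j hu0.ne')
      (contDiff_radialDerivMult hd hβ0 j u) (fun ξ => ?_) f
    have h1 := (hb j hj (u • ξ)).2
    rw [map_smul, norm_smul, Real.norm_of_nonneg hu0.le, mul_pow] at h1
    have hδ' : δ = 2 ^ k * (2 ^ j)⁻¹ := by
      rw [hδ, zpow_sub₀ (by norm_num), zpow_natCast, div_eq_mul_inv]
    have hku : (2 : ℝ) ^ k ≤ u := hka.trans hu.1.le
    rw [hM, hδ', radialDerivMult]
    set Y := ‖fderiv ℝ (localMult d β0 j) (u • ξ) ξ‖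
    set P := ((2 : ℝ) ^ j) ^ (d - 1)
    have hP : 0 < P := by positivity
    have h2 : ((2 : ℝ) ^ k) ^ 2 * Y ^ 2 * P ≤ C * (2 ^ j) ^ 2 := by
      refine le_trans ?_ h1
      gcongr
    have : C * P⁻¹ * ((2 ^ k * (2 ^ j)⁻¹) ^ 2)⁻¹ = C * (2 ^ j) ^ 2 / (((2 : ℝ) ^ k) ^ 2 * P) := by
      field_simp
    rw [this, le_div_iff₀ (by positivity)]
    linarith
  have hmeas := measurable_multOp_radialDerivMult hd hβ0 j f
  have hI : ∫⁻ x, (∫⁻ u in Ioc a b, ‖multOp d (radialDerivMult d β0 j u) f x‖ₑ) ^ 2 ≤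
      ENNReal.ofReal M * F := by
    calc _ ≤ ∫⁻ x, ENNReal.ofReal δ *
          ∫⁻ u in Ioc a b, ‖multOp d (radialDerivMult d β0 j u) f x‖ₑ ^ 2 := by
          refine lintegral_mono fun x => ?_
          refine (lintegral_sq_le_measure_mul _
            ((hmeas.comp (by fun_prop : Measurable fun u : ℝ => (u, x))).enorm.aemeasurable)).trans
            ?_
          simp only [Measure.restrict_apply_univ, Real.volume_Ioc, Function.comp_apply]
          gcongr
      _ = ENNReal.ofReal δ *
          ∫⁻ u in Ioc a b, ∫⁻ x, ‖multOp d (radialDerivMult d β0 j u) f x‖ₑ ^ 2 := by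
          rw [lintegral_const_mul' _ _ ENNReal.ofReal_ne_top, lintegral_lintegral_swap]
          exact ((hmeas.comp measurable_swap).enorm.pow_const 2).aemeasurable
      _ ≤ ENNReal.ofReal δ * ∫⁻ u in Ioc a b, ENNReal.ofReal (M * (δ ^ 2)⁻¹) * F := by
          gcongr 1
          exact setLIntegral_mono' measurableSet_Ioc hB
      _ ≤ ENNReal.ofReal δ * (ENNReal.ofReal (M * (δ ^ 2)⁻¹) * F * ENNReal.ofReal δ) := by
          rw [setLIntegral_const, Real.volume_Ioc]
          gcongr
      _ = ENNReal.ofReal (δ * (M * (δ ^ 2)⁻¹) * δ) * F := by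
          rw [ENNReal.ofReal_mul (p := δ * _) (by positivity),
            ENNReal.ofReal_mul (p := δ) (by positivity)]
          ring
      _ = _ := by
          congr 2
          field_simp
  have hAm : Measurable (fun x => ‖Aj d β0 j a f x‖ₑ) := by
    obtain ⟨g, hg, -⟩ := exists_schwartz_multOp
      (hasCompactSupport_comp_smul (hasCompactSupport_localMult hβ0 j) ha.ne')
      ((contDiff_localMult hd hβ0 j).comp (contDiff_const_smul a)) f
    rw [Aj_eq_multOp, ← hg]
    exact g.continuous.measurable.enorm
  calc _ ≤ ∫⁻ x, 2 * (‖Aj d β0 j a f x‖ₑ ^ 2 +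
        (∫⁻ u in Ioc a b, ‖multOp d (radialDerivMult d β0 j u) f x‖ₑ) ^ 2) := by
        refine lintegral_mono fun x => ?_
        have h := ENNReal.rpow_add_le_mul_rpow_add_rpow ‖Aj d β0 j a f x‖ₑ
          (∫⁻ u in Ioc a b, ‖multOp d (radialDerivMult d β0 j u) f x‖ₑ) (one_le_two (α := ℝ))
        norm_num at h
        refine le_trans ?_ h
        gcongr
        exact supAj_Icc_le hd hβ0 j ha f x
    _ = 2 * ((∫⁻ x, ‖Aj d β0 j a f x‖ₑ ^ 2) +
        ∫⁻ x, (∫⁻ u in Ioc a b, ‖multOp d (radialDerivMult d β0 j u) f x‖ₑ) ^ 2) := by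
        rw [lintegral_const_mul' _ _ (by norm_num), lintegral_add_left (hAm.pow_const 2)]
    _ ≤ 2 * (ENNReal.ofReal M * F + ENNReal.ofReal M * F) := by gcongr
    _ = _ := by
        rw [mul_assoc 4 C, ← hM, ENNReal.ofReal_mul (p := 4) (by norm_num)]
        clear_value M
        norm_num
        ring

end MaximalL2

section MaximalL1
open FourierTransform

variable {d : ℕ} {β0 : Ed d → ℝ}

lemma multOp_eq_integral_kernel {h : Ed d → ℂ} (hc : HasCompactSupport h) (hs : Continuous h)
    (f : SchwartzMap (Ed d) ℂ) (w : Ed d) :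
    multOp d h f w = ∫ z, f z * ∫ ξ, eChar (2 * Real.pi * ⟪ξ, w - z⟫) * h ξ := by
  have hi : Integrable (fun q : Ed d × Ed d => eChar (2 * Real.pi * ⟪q.1, w⟫) *
      (h q.1 * (eChar (-(2 * Real.pi * ⟪q.1, q.2⟫)) * f q.2))) (volume.prod volume) := by
    have h1 : Integrable (fun q : Ed d × Ed d => h q.1 * f q.2) (volume.prod volume) :=
      (hs.integrable_of_hasCompactSupport hc).mul_prod f.integrable
    have hf := f.continuous
    refine h1.mono (Continuous.aestronglyMeasurable (by fun_prop))
      (Eventually.of_forall fun q => ?_)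
    simp [norm_eChar]
  calc _ = ∫ ξ, ∫ z, eChar (2 * Real.pi * ⟪ξ, w⟫) *
        (h ξ * (eChar (-(2 * Real.pi * ⟪ξ, z⟫)) * f z)) := by
        simp_rw [multOp, fourierInt, integral_const_mul]
    _ = ∫ z, ∫ ξ, eChar (2 * Real.pi * ⟪ξ, w⟫) *
        (h ξ * (eChar (-(2 * Real.pi * ⟪ξ, z⟫)) * f z)) := integral_integral_swap hi
    _ = _ := by
        congr 1
        ext z
        rw [← integral_const_mul]
        congr 1
        ext ξ
        rw [inner_sub_right, mul_sub, sub_eq_add_neg, eChar_add]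
        ring

lemma multOp_sigmaHat_mul (hd : 2 ≤ d) {h : Ed d → ℂ} (hc : HasCompactSupport h)
    (hs : Continuous h) (t : ℝ) (f : SchwartzMap (Ed d) ℂ) (x : Ed d) :
    multOp d (fun ξ => sigmaHat d (t • ξ) * h ξ) f x =
      ∫ y, multOp d h f (x - t • y) ∂sphereLaw d := by
  have := isProbabilityMeasure_sphereLaw hd
  have hf := (𝓕 f).continuous
  have hi : Integrable (fun q : Ed d × Ed d => eChar (2 * Real.pi * ⟪q.1, x⟫) *
      ((eChar (-(2 * Real.pi * ⟪t • q.1, q.2⟫)) * h q.1) * 𝓕 f q.1))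
      (volume.prod (sphereLaw d)) := by
    have h1 : Integrable (fun q : Ed d × Ed d => (h q.1 * 𝓕 f q.1) * (1 : ℂ))
        (volume.prod (sphereLaw d)) :=
      ((hs.mul hf).integrable_of_hasCompactSupport hc.mul_right).mul_prod (integrable_const _)
    refine h1.mono (Continuous.aestronglyMeasurable (by fun_prop))
      (Eventually.of_forall fun q => ?_)
    simp [norm_eChar]
  calc _ = ∫ ξ, ∫ y, eChar (2 * Real.pi * ⟪ξ, x⟫) *
        ((eChar (-(2 * Real.pi * ⟪t • ξ, y⟫)) * h ξ) * 𝓕 f ξ) ∂sphereLaw d := by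
        simp_rw [multOp, fourierInt_eq, integral_const_mul, integral_mul_const]
        congr 1
        ext ξ
        rw [sigmaHat_eq_weighted, weightedSigmaHat]
        simp
    _ = ∫ y, (∫ ξ, eChar (2 * Real.pi * ⟪ξ, x⟫) *
        ((eChar (-(2 * Real.pi * ⟪t • ξ, y⟫)) * h ξ) * 𝓕 f ξ)) ∂sphereLaw d :=
        integral_integral_swap hi
    _ = _ := by
        congr 1
        ext y
        rw [multOp]
        congr 1
        ext ξ
        rw [inner_sub_right, mul_sub, sub_eq_add_neg, eChar_add, fourierInt_eq,
          real_inner_smul_left, real_inner_smul_right]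
        ring

lemma kernel_comp_smul (β : Ed d → ℂ) {s : ℝ} (hs : 0 < s) (w : Ed d) :
    ∫ ξ, eChar (2 * Real.pi * ⟪ξ, w⟫) * β (s • ξ) =
      ((s ^ d)⁻¹ : ℝ) * ∫ ξ, eChar (2 * Real.pi * ⟪ξ, s⁻¹ • w⟫) * β ξ := by
  have h := Measure.integral_comp_smul (volume : Measure (Ed d))
    (fun ξ => eChar (2 * Real.pi * ⟪ξ, s⁻¹ • w⟫) * β ξ) s
  rw [abs_of_pos (by positivity), finrank_euclideanSpace_fin, Complex.real_smul] at h
  rw [← h]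
  congr 1
  ext ξ
  rw [real_inner_smul_left, real_inner_smul_right, mul_inv_cancel_left₀ hs.ne']

lemma exists_kernel_decay {β : Ed d → ℂ} (hc : HasCompactSupport β)
    (hs : ContDiff ℝ (⊤ : ℕ∞) β) : ∃ K : ℝ, 0 < K ∧ ∀ w : Ed d,
      ‖∫ ξ, eChar (2 * Real.pi * ⟪ξ, w⟫) * β ξ‖ ≤ K * (1 + ‖w‖) ^ (-((d : ℝ) + 1)) := by
  set g : SchwartzMap (Ed d) ℂ := 𝓕⁻ (hc.toSchwartzMap hs) with hg
  have hgw (w : Ed d) : ∫ ξ, eChar (2 * Real.pi * ⟪ξ, w⟫) * β ξ = g w := by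
    rw [hg, SchwartzMap.fourierInv_coe, Real.fourierInv_eq]
    rfl
  set K₀ := (2 : ℝ) ^ (d + 1) *
    (Finset.Iic (d + 1, 0)).sup (fun m => SchwartzMap.seminorm ℝ m.1 m.2) g
  have hK₀ (w : Ed d) : (1 + ‖w‖) ^ (d + 1) * ‖g w‖ ≤ K₀ := by
    simpa using SchwartzMap.one_add_le_sup_seminorm_apply (𝕜 := ℝ) (m := (d + 1, 0))
      (k := d + 1) (n := 0) le_rfl le_rfl g w
  refine ⟨|K₀| + 1, by positivity, fun w => ?_⟩
  have hw : (0 : ℝ) < 1 + ‖w‖ := by positivity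
  rw [hgw, Real.rpow_neg hw.le, ← div_eq_mul_inv, le_div_iff₀ (by positivity),
    show ((d : ℝ) + 1) = ((d + 1 : ℕ) : ℝ) by push_cast; rfl, Real.rpow_natCast]
  linarith [hK₀ w, le_abs_self K₀]

lemma lintegral_comp_smul (g : Ed d → ℝ≥0∞) (hg : Measurable g) {s : ℝ} (hs : 0 < s) :
    ∫⁻ w, g (s • w) = ENNReal.ofReal ((s ^ d)⁻¹) * ∫⁻ w, g w := by
  have h := Measure.map_addHaar_smul (volume : Measure (Ed d)) hs.ne'
  rw [abs_of_pos (by positivity), finrank_euclideanSpace_fin] at h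
  rw [← lintegral_map hg (by fun_prop : Measurable fun w : Ed d => s • w), h,
    lintegral_smul_measure, smul_eq_mul]

lemma exists_lintegral_supAj_le (hd : 2 ≤ d) (hβ0 : IsAdmissibleBump d β0) :
    ∃ C : ℝ, 0 < C ∧ ∀ (k : ℤ) (j : ℕ) (a b : ℝ), (2 : ℝ) ^ k ≤ a → b ≤ 2 ^ (k + 1) →
      b - a ≤ (2 : ℝ) ^ (k - (j : ℤ)) → ∀ f : SchwartzMap (Ed d) ℂ,
      ∫⁻ x, supAj d β0 j (Icc a b) f x ≤ ENNReal.ofReal C * ∫⁻ x, ‖f x‖ₑ := by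
  have := isProbabilityMeasure_sphereLaw hd
  set β : Ed d → ℂ := fun ξ => (betaJ d β0 0 ξ : ℂ) with hβ
  have hβc : HasCompactSupport β :=
    (hasCompactSupport_betaJ hβ0 0).comp_left (g := fun r : ℝ => (r : ℂ)) (by simp)
  have hβs : ContDiff ℝ (⊤ : ℕ∞) β := Complex.ofRealCLM.contDiff.comp (contDiff_betaJ hβ0 0)
  obtain ⟨K, hK, hKb⟩ := exists_kernel_decay hβc hβs
  set G : Ed d → ℝ := fun w => (1 + ‖w‖) ^ (-((d : ℝ) + 1)) with hG
  have hG0 (w : Ed d) : 0 ≤ G w := by positivity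
  have hGm : Measurable G := by fun_prop
  set I : ℝ≥0∞ := ∫⁻ w, ENNReal.ofReal (G w) with hI
  have hItop : I ≠ ∞ :=
    (finite_integral_one_add_norm (μ := (volume : Measure (Ed d))) (r := (d : ℝ) + 1)
      (by rw [finrank_euclideanSpace_fin]; linarith)).ne
  set L : ℝ := K * 2 ^ ((d : ℝ) + 1) with hL
  have hL0 : 0 < L := by positivity
  refine ⟨L * (I.toReal + 1), by positivity, fun k j a b hka hbk hab f => ?_⟩
  have hk : (0 : ℝ) < 2 ^ k := by positivity
  have ha : 0 < a := hk.trans_le hka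
  set ρ : ℝ := 2 ^ j * (2 ^ k)⁻¹ with hρ
  have hρ0 : 0 < ρ := by positivity
  have hδρ : (2 : ℝ) ^ (k - (j : ℤ)) = ρ⁻¹ := by
    rw [hρ, zpow_sub₀ (by norm_num), zpow_natCast, mul_inv, inv_inv, div_eq_mul_inv, mul_comm]
  have hker (t : ℝ) (ht : t ∈ Icc a b) (y z x : Ed d) (hy : ‖y‖ = 1) :
      ‖∫ ξ, eChar (2 * Real.pi * ⟪ξ, x - t • y - z⟫) * β ((t * (2 ^ j)⁻¹) • ξ)‖ ≤
        L * ρ ^ d * G (ρ • (x - a • y - z)) := by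
    have ht0 : 0 < t := ha.trans_le ht.1
    set s := t * ((2 : ℝ) ^ j)⁻¹ with hs
    have hs0 : 0 < s := by positivity
    have hs1 : s⁻¹ ≤ ρ := by
      rw [hs, hρ, mul_inv, inv_inv, mul_comm]
      gcongr
      exact hka.trans ht.1
    have hs2 : ρ ≤ 2 * s⁻¹ := by
      have : t ≤ 2 * 2 ^ k := by
        have := ht.2.trans hbk
        rwa [zpow_add₀ (by norm_num), zpow_one, mul_comm] at this
      rw [hs, hρ, mul_inv, inv_inv, mul_comm, ← mul_assoc]
      gcongr
      rw [inv_le_iff_one_le_mul₀ hk, mul_assoc, inv_mul_eq_div, mul_div_assoc', one_le_div ht0]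
      exact this
    rw [kernel_comp_smul β hs0, norm_mul, Complex.norm_real, Real.norm_of_nonneg (by positivity)]
    set w := x - t • y - z with hw
    set v := x - a • y - z with hv
    have hvw : ‖v‖ ≤ ‖w‖ + ρ⁻¹ := by
      have e : v = w + (t - a) • y := by rw [hv, hw, sub_smul]; abel
      rw [e]
      refine (norm_add_le _ _).trans ?_
      rw [norm_smul, hy, mul_one, Real.norm_of_nonneg (by linarith [ht.1]), ← hδρ]
      linarith [ht.2]
    have hmain : 1 + ‖ρ • v‖ ≤ 2 * (1 + ‖s⁻¹ • w‖) := by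
      rw [norm_smul, norm_smul, Real.norm_of_nonneg hρ0.le, Real.norm_of_nonneg (by positivity)]
      have e1 : ρ * ‖v‖ ≤ ρ * ‖w‖ + 1 := by
        calc _ ≤ ρ * (‖w‖ + ρ⁻¹) := by gcongr
          _ = _ := by rw [mul_add, mul_inv_cancel₀ hρ0.ne']
      have e2 : ρ * ‖w‖ ≤ 2 * s⁻¹ * ‖w‖ := by gcongr
      linarith
    have hGG : G (s⁻¹ • w) ≤ 2 ^ ((d : ℝ) + 1) * G (ρ • v) := by
      have e : (2 * (1 + ‖s⁻¹ • w‖)) ^ (-((d : ℝ) + 1)) ≤ (1 + ‖ρ • v‖) ^ (-((d : ℝ) + 1)) :=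
        Real.rpow_le_rpow_of_nonpos (by positivity) hmain (by linarith [Nat.cast_nonneg (α := ℝ) d])
      rw [Real.mul_rpow (by norm_num) (by positivity), Real.rpow_neg (by norm_num),
        inv_mul_le_iff₀ (by positivity)] at e
      exact e
    calc _ ≤ (s ^ d)⁻¹ * (K * G (s⁻¹ • w)) := by gcongr; exact hKb _
      _ ≤ ρ ^ d * (K * (2 ^ ((d : ℝ) + 1) * G (ρ • v))) := by
        rw [← inv_pow]
        gcongr
      _ = _ := by rw [hL]; ring
  set H : Ed d → ℝ≥0∞ := fun w => ENNReal.ofReal (L * ρ ^ d * G (ρ • w)) with hH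
  have hHm : Measurable H := by fun_prop
  have hHI : ∫⁻ w, H w = ENNReal.ofReal L * I := by
    have e (w : Ed d) : H w = ENNReal.ofReal (L * ρ ^ d) * ENNReal.ofReal (G (ρ • w)) := by
      rw [hH, ← ENNReal.ofReal_mul (by positivity)]
    simp_rw [e]
    rw [lintegral_const_mul _ (by fun_prop),
      lintegral_comp_smul (fun w => ENNReal.ofReal (G w)) (by fun_prop) hρ0, ← mul_assoc,
      ← ENNReal.ofReal_mul (by positivity), mul_assoc, mul_inv_cancel₀ (by positivity), mul_one]
  have hpt (x : Ed d) : supAj d β0 j (Icc a b) f x ≤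
      ∫⁻ y, (∫⁻ z, ‖f z‖ₑ * H (x - a • y - z)) ∂sphereLaw d := by
    refine iSup₂_le fun t ht => ?_
    have ht0 : 0 < t := ha.trans_le ht.1
    have hs0 : t * ((2 : ℝ) ^ j)⁻¹ ≠ 0 := by positivity
    have hm : (fun ξ => localMult d β0 j (t • ξ)) =
        fun ξ => sigmaHat d (t • ξ) * β ((t * (2 ^ j)⁻¹) • ξ) := by
      ext ξ
      simp only [localMult, hβ]
      rw [betaJ_eq, smul_smul, mul_comm t]
    have hc := hasCompactSupport_comp_smul hβc hs0
    have hs : Continuous fun ξ => β ((t * (2 ^ j)⁻¹) • ξ) :=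
      hβs.continuous.comp (continuous_const_smul _)
    rw [← enorm_eq_nnnorm, Aj_eq_multOp, hm, multOp_sigmaHat_mul hd hc hs]
    refine (enorm_integral_le_lintegral_enorm _).trans (lintegral_mono_ae ?_)
    filter_upwards [ae_norm_eq_one_sphereLaw d] with y hy
    rw [multOp_eq_integral_kernel hc hs]
    refine (enorm_integral_le_lintegral_enorm _).trans (lintegral_mono fun z => ?_)
    rw [enorm_mul]
    gcongr
    rw [← ofReal_norm]
    exact ENNReal.ofReal_le_ofReal (hker t ht y z x hy)
  have hfm : Measurable fun z => ‖f z‖ₑ := f.continuous.measurable.enorm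
  calc _ ≤ ∫⁻ x, ∫⁻ y, (∫⁻ z, ‖f z‖ₑ * H (x - a • y - z)) ∂sphereLaw d := lintegral_mono hpt
    _ = ∫⁻ y, (∫⁻ x, ∫⁻ z, ‖f z‖ₑ * H (x - a • y - z)) ∂sphereLaw d := by
      rw [lintegral_lintegral_swap]
      refine (Measurable.lintegral_prod_right' (ν := volume)
        (f := fun q : (Ed d × Ed d) × Ed d => ‖f q.2‖ₑ * H (q.1.1 - a • q.1.2 - q.2))
        ?_).aemeasurable
      exact (hfm.comp measurable_snd).mul (by fun_prop)
    _ = ∫⁻ y, (∫⁻ z, ∫⁻ x, ‖f z‖ₑ * H (x - a • y - z)) ∂sphereLaw d := by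
      congr 1
      ext y
      rw [lintegral_lintegral_swap]
      exact ((hfm.comp measurable_snd).mul (by fun_prop)).aemeasurable
    _ = ∫⁻ y, (∫⁻ z, ‖f z‖ₑ * (ENNReal.ofReal L * I)) ∂sphereLaw d := by
      congr 1
      ext y
      congr 1
      ext z
      rw [lintegral_const_mul _ (by fun_prop), ← hHI]
      simp_rw [sub_sub]
      rw [lintegral_sub_right_eq_self]
    _ = ENNReal.ofReal L * I * ∫⁻ z, ‖f z‖ₑ := by
      rw [lintegral_const, measure_univ, mul_one, lintegral_mul_const _ hfm, mul_comm]
    _ ≤ _ := by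
      rw [ENNReal.ofReal_mul hL0.le]
      gcongr
      rw [← ENNReal.ofReal_toReal hItop]
      exact ENNReal.ofReal_le_ofReal (by simp)

end MaximalL1

section Interpolation

variable {E : Type*} [NormedAddCommGroup E] [InnerProductSpace ℝ E] [FiniteDimensional ℝ E]

lemma SchwartzMap.exists_truncation (f : SchwartzMap E ℂ) {s : ℝ} (hs : 0 < s) :
    ∃ g h : SchwartzMap E ℂ, f = g + h ∧
      (∀ x, ‖g x‖ₑ ≤ if s < ‖f x‖ then ‖f x‖ₑ else 0) ∧
      ∀ x, ‖h x‖ₑ ≤ if ‖f x‖ < 2 * s then ‖f x‖ₑ else 0 := by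
  set χ : E → ℝ := fun x => Real.smoothTransition (‖f x‖ ^ 2 / s ^ 2 - 1) with hχ
  have hχs : ContDiff ℝ (⊤ : ℕ∞) χ :=
    Real.smoothTransition.contDiff.comp
      ((((f.smooth _).norm_sq ℂ).div_const _).sub contDiff_const)
  have hχ0 (x : E) (hx : ‖f x‖ ≤ s) : χ x = 0 := by
    refine Real.smoothTransition.zero_of_nonpos ?_
    rw [sub_nonpos, div_le_one (by positivity)]
    gcongr
  have hχ1 (x : E) (hx : 2 * s ≤ ‖f x‖) : χ x = 1 := by
    refine Real.smoothTransition.one_of_one_le ?_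
    rw [le_sub_iff_add_le, le_div_iff₀ (by positivity)]
    nlinarith
  have hc : HasCompactSupport (fun x => (χ x : ℂ) * f x) := by
    have h := (f.tendsto_cocompact).eventually (ball_mem_nhds 0 hs)
    obtain ⟨K, hK, hKs⟩ := mem_cocompact.1 h
    refine HasCompactSupport.intro hK fun x hx => ?_
    have : ‖f x‖ < s := by simpa using hKs hx
    simp [hχ0 x this.le]
  have hsm : ContDiff ℝ (⊤ : ℕ∞) (fun x => (χ x : ℂ) * f x) :=
    (Complex.ofRealCLM.contDiff.comp hχs).mul (f.smooth _)
  set g := hc.toSchwartzMap hsm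
  have hg (x : E) : g x = (χ x : ℂ) * f x := rfl
  refine ⟨g, f - g, by simp, fun x => ?_, fun x => ?_⟩
  · rw [hg]
    split_ifs with h
    · rw [enorm_le_iff_norm_le, norm_mul, Complex.norm_real,
        Real.norm_of_nonneg (Real.smoothTransition.nonneg _)]
      exact mul_le_of_le_one_left (norm_nonneg _) (Real.smoothTransition.le_one _)
    · simp [hχ0 x (not_lt.1 h)]
  · have e : (f - g) x = ((1 - χ x : ℝ) : ℂ) * f x := by
      rw [sub_apply, hg]
      push_cast
      ring
    rw [e]
    split_ifs with h
    · rw [enorm_le_iff_norm_le, norm_mul, Complex.norm_real,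
        Real.norm_of_nonneg (sub_nonneg.2 (Real.smoothTransition.le_one _))]
      exact mul_le_of_le_one_left (norm_nonneg _)
        (by linarith [Real.smoothTransition.nonneg (‖f x‖ ^ 2 / s ^ 2 - 1)])
    · simp [hχ1 x (not_lt.1 h)]

lemma lintegral_rpow_indicator_lt {p γ r : ℝ} (hp : 1 < p) (hγ : 0 < γ) (hr : 0 ≤ r) :
    ∫⁻ l in Ioi (0 : ℝ), ENNReal.ofReal (l ^ (p - 2)) *
      (if γ * l < r then ENNReal.ofReal r else 0) ≤
      ENNReal.ofReal (((p - 1) * γ ^ (p - 1))⁻¹ * r ^ p) := by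
  have hR : 0 ≤ r / γ := by positivity
  have h1 : ∫⁻ l in Ioc 0 (r / γ), ENNReal.ofReal (l ^ (p - 2)) =
      ENNReal.ofReal ((r / γ) ^ (p - 1) / (p - 1)) := by
    have hi := (intervalIntegral.intervalIntegrable_rpow' (a := 0) (b := r / γ) (r := p - 2)
      (by linarith)).1
    rw [← ofReal_integral_eq_lintegral_ofReal hi, ← intervalIntegral.integral_of_le hR,
      integral_rpow (Or.inl (by linarith)), show p - 2 + 1 = p - 1 by ring,
      Real.zero_rpow (by linarith), sub_zero]
    filter_upwards [ae_restrict_mem measurableSet_Ioc] with l hl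
    exact Real.rpow_nonneg hl.1.le _
  calc _ ≤ ∫⁻ l in Ioi (0 : ℝ), (Ioc 0 (r / γ)).indicator
        (fun l => ENNReal.ofReal (l ^ (p - 2)) * ENNReal.ofReal r) l := by
        refine setLIntegral_mono' measurableSet_Ioi fun l hl => ?_
        split_ifs with h
        · rw [indicator_of_mem]
          exact ⟨hl, by rw [le_div_iff₀ hγ, mul_comm]; exact h.le⟩
        · simp
    _ ≤ ∫⁻ l, (Ioc 0 (r / γ)).indicator
        (fun l => ENNReal.ofReal (l ^ (p - 2)) * ENNReal.ofReal r) l :=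
          setLIntegral_le_lintegral _ _
    _ = ENNReal.ofReal ((r / γ) ^ (p - 1) / (p - 1) * r) := by
        rw [lintegral_indicator measurableSet_Ioc, lintegral_mul_const' _ _ ENNReal.ofReal_ne_top,
          h1, ← ENNReal.ofReal_mul (by have : 0 < p - 1 := by linarith
                                       positivity)]
    _ = _ := by
        congr 1
        rw [Real.div_rpow hr hγ.le]
        have e : r ^ p = r ^ (p - 1) * r := by
          rw [← Real.rpow_add_one' hr (by linarith), sub_add_cancel]
        rw [e]
        have : p - 1 ≠ 0 := by linarith
        field_simp

lemma lintegral_rpow_indicator_gt {p γ r : ℝ} (hp : p < 2) (hγ : 0 < γ)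
    (hr : 0 ≤ r) :
    ∫⁻ l in Ioi (0 : ℝ), ENNReal.ofReal (l ^ (p - 3)) *
      (if r < 2 * (γ * l) then ENNReal.ofReal r ^ 2 else 0) ≤
      ENNReal.ofReal ((2 * γ) ^ (2 - p) / (2 - p) * r ^ p) := by
  rcases hr.eq_or_lt with rfl | hr
  · simp
  have hR : 0 < r / (2 * γ) := by positivity
  have h1 : ∫⁻ l in Ioi (r / (2 * γ)), ENNReal.ofReal (l ^ (p - 3)) =
      ENNReal.ofReal ((r / (2 * γ)) ^ (p - 2) / (2 - p)) := by
    rw [← ofReal_integral_eq_lintegral_ofReal (integrableOn_Ioi_rpow_of_lt (by linarith) hR),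
      integral_Ioi_rpow_of_lt (by linarith) hR, show p - 3 + 1 = p - 2 by ring,
      ← neg_sub p 2, div_neg, neg_div]
    filter_upwards [ae_restrict_mem measurableSet_Ioi] with l hl
    exact Real.rpow_nonneg (hR.trans hl).le _
  calc _ ≤ ∫⁻ l in Ioi (0 : ℝ), (Ioi (r / (2 * γ))).indicator
        (fun l => ENNReal.ofReal (l ^ (p - 3)) * ENNReal.ofReal r ^ 2) l := by
        refine setLIntegral_mono' measurableSet_Ioi fun l hl => ?_
        split_ifs with h
        · rw [indicator_of_mem]
          rw [mem_Ioi, div_lt_iff₀ (by positivity)]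
          linarith
        · simp
    _ ≤ ∫⁻ l, (Ioi (r / (2 * γ))).indicator
        (fun l => ENNReal.ofReal (l ^ (p - 3)) * ENNReal.ofReal r ^ 2) l :=
        setLIntegral_le_lintegral _ _
    _ = ENNReal.ofReal ((r / (2 * γ)) ^ (p - 2) / (2 - p) * r ^ 2) := by
        have : 0 < 2 - p := by linarith
        rw [lintegral_indicator measurableSet_Ioi, lintegral_mul_const' _ _ (by finiteness),
          h1, ENNReal.ofReal_mul (by positivity), ENNReal.ofReal_pow hr.le]
    _ = _ := by
        congr 1
        rw [Real.div_rpow hr.le (by positivity)]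
        have e : r ^ p = r ^ (p - 2) * r ^ 2 := by
          rw [← Real.rpow_natCast, ← Real.rpow_add hr]
          norm_num
        have e2 : (2 * γ) ^ (2 - p) = ((2 * γ) ^ (p - 2))⁻¹ := by
          rw [← Real.rpow_neg (by positivity), neg_sub]
        rw [e, e2]
        have : 2 - p ≠ 0 := by linarith
        field_simp

variable [MeasurableSpace E] [BorelSpace E]

lemma meas_lt_le_truncation {T : SchwartzMap E ℂ → E → ℝ≥0∞} {A₁ A₂ : ℝ}
    (hT : ∀ f, Measurable (T f)) (hadd : ∀ f g x, T (f + g) x ≤ T f x + T g x)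
    (h1 : ∀ f, ∫⁻ x, T f x ≤ ENNReal.ofReal A₁ * ∫⁻ x, ‖f x‖ₑ)
    (h2 : ∀ f, ∫⁻ x, T f x ^ 2 ≤ ENNReal.ofReal A₂ * ∫⁻ x, ‖f x‖ₑ ^ 2)
    (f : SchwartzMap E ℂ) {γ l : ℝ} (hγ : 0 < γ) (hl : 0 < l) :
    volume {x | l < (T f x).toReal} ≤
      (ENNReal.ofReal A₁ * ∫⁻ x, if γ * l < ‖f x‖ then ‖f x‖ₑ else 0) / ENNReal.ofReal (l / 2) +
      (ENNReal.ofReal A₂ * ∫⁻ x, if ‖f x‖ < 2 * (γ * l) then ‖f x‖ₑ ^ 2 else 0) /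
        ENNReal.ofReal (l / 2) ^ 2 := by
  obtain ⟨g, h, rfl, hg, hh⟩ := f.exists_truncation (mul_pos hγ hl)
  set f := g + h
  set ε := ENNReal.ofReal (l / 2) with hε
  have hε0 : ε ≠ 0 := by simp [hε, hl]
  have hεt : ε ≠ ∞ := ENNReal.ofReal_ne_top
  have hsub : {x | l < (T f x).toReal} ⊆ {x | ε ≤ T g x} ∪ {x | ε ^ 2 ≤ T h x ^ 2} := by
    intro x hx
    by_contra hcon
    simp only [mem_union, mem_ofPred_eq, not_or, not_le] at hcon hx
    have hlt : T h x < ε := lt_of_not_ge fun hge => hcon.2.not_ge (pow_le_pow_left' hge 2)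
    have : T f x < ε + ε := (hadd g h x).trans_lt (ENNReal.add_lt_add hcon.1 hlt)
    rw [hε, ← ENNReal.ofReal_add (by positivity) (by positivity), add_halves] at this
    exact absurd (ENNReal.toReal_le_of_le_ofReal hl.le this.le) (not_le.2 hx)
  calc _ ≤ volume {x | ε ≤ T g x} + volume {x | ε ^ 2 ≤ T h x ^ 2} :=
        (measure_mono hsub).trans (measure_union_le _ _)
    _ ≤ (∫⁻ x, T g x) / ε + (∫⁻ x, T h x ^ 2) / ε ^ 2 := by
        gcongr
        · exact meas_ge_le_lintegral_div (hT g).aemeasurable hε0 hεt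
        · exact meas_ge_le_lintegral_div ((hT h).pow_const 2).aemeasurable (by simp [hε0])
            (by finiteness)
    _ ≤ _ := by
        gcongr ?_ / _ + ?_ / _
        · refine (h1 g).trans ?_
          gcongr with x
          exact hg x
        · refine (h2 h).trans ?_
          gcongr with x
          refine (pow_le_pow_left' (hh x) 2).trans ?_
          split_ifs <;> simp

lemma lintegral_rpow_le_of_truncation {T : SchwartzMap E ℂ → E → ℝ≥0∞} {A₁ A₂ p γ : ℝ}
    (hA₁ : 0 ≤ A₁) (hA₂ : 0 ≤ A₂) (hp1 : 1 < p) (hp2 : p < 2) (hγ : 0 < γ)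
    (hT : ∀ f, Measurable (T f)) (hadd : ∀ f g x, T (f + g) x ≤ T f x + T g x)
    (h1 : ∀ f, ∫⁻ x, T f x ≤ ENNReal.ofReal A₁ * ∫⁻ x, ‖f x‖ₑ)
    (h2 : ∀ f, ∫⁻ x, T f x ^ 2 ≤ ENNReal.ofReal A₂ * ∫⁻ x, ‖f x‖ₑ ^ 2)
    (f : SchwartzMap E ℂ) :
    ∫⁻ x, T f x ^ p ≤ ENNReal.ofReal
      (p * (2 * A₁ * ((p - 1) * γ ^ (p - 1))⁻¹ + 4 * A₂ * ((2 * γ) ^ (2 - p) / (2 - p)))) *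
      ∫⁻ x, ‖f x‖ₑ ^ p := by
  have hp0 : 0 < p := by linarith
  have hf := f.continuous.measurable
  have hfin : ∀ᵐ x, T f x ≠ ∞ := by
    refine (ae_lt_top (hT f) (ne_of_lt ((h1 f).trans_lt ?_))).mono fun x hx => hx.ne
    exact ENNReal.mul_lt_top ENNReal.ofReal_lt_top f.integrable.hasFiniteIntegral
  have hlc : ∫⁻ x, T f x ^ p = ENNReal.ofReal p * ∫⁻ l in Ioi (0 : ℝ),
      volume {x | l < (T f x).toReal} * ENNReal.ofReal (l ^ (p - 1)) := by
    rw [← lintegral_rpow_eq_lintegral_meas_lt_mul volume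
      (Eventually.of_forall fun x => ENNReal.toReal_nonneg) (hT f).ennreal_toReal.aemeasurable hp0]
    refine lintegral_congr_ae ?_
    filter_upwards [hfin] with x hx
    rw [ENNReal.toReal_rpow, ENNReal.ofReal_toReal (by finiteness)]
  set G₁ : ℝ → E → ℝ≥0∞ := fun l x => ENNReal.ofReal (l ^ (p - 2)) *
    (if γ * l < ‖f x‖ then ‖f x‖ₑ else 0) with hG₁
  set G₂ : ℝ → E → ℝ≥0∞ := fun l x => ENNReal.ofReal (l ^ (p - 3)) *
    (if ‖f x‖ < 2 * (γ * l) then ‖f x‖ₑ ^ 2 else 0) with hG₂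
  have hG₁m : Measurable (Function.uncurry G₁) := by
    refine Measurable.mul (by fun_prop) (Measurable.ite ?_ (by fun_prop) measurable_const)
    exact measurableSet_lt (by fun_prop) (by fun_prop)
  have hG₂m : Measurable (Function.uncurry G₂) := by
    refine Measurable.mul (by fun_prop) (Measurable.ite ?_ (by fun_prop) measurable_const)
    exact measurableSet_lt (by fun_prop) (by fun_prop)
  have hw (l : ℝ) (hl : l ∈ Ioi (0 : ℝ)) :
      volume {x | l < (T f x).toReal} * ENNReal.ofReal (l ^ (p - 1)) ≤
        ENNReal.ofReal (2 * A₁) * (∫⁻ x, G₁ l x) + ENNReal.ofReal (4 * A₂) * ∫⁻ x, G₂ l x := by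
    have hl : 0 < l := hl
    refine (mul_le_mul_left (meas_lt_le_truncation hT hadd h1 h2 f hγ hl) _).trans (le_of_eq ?_)
    simp only [hG₁, hG₂]
    rw [lintegral_const_mul' _ _ ENNReal.ofReal_ne_top,
      lintegral_const_mul' _ _ ENNReal.ofReal_ne_top, add_mul, ENNReal.div_eq_inv_mul,
      ENNReal.div_eq_inv_mul,
      ← ENNReal.ofReal_pow (by positivity), ← ENNReal.ofReal_inv_of_pos (by positivity),
      ← ENNReal.ofReal_inv_of_pos (by positivity)]
    congr 1
    · set J := ∫⁻ x, if γ * l < ‖f x‖ then ‖f x‖ₑ else 0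
      calc _ = (ENNReal.ofReal A₁ * ENNReal.ofReal (l / 2)⁻¹ *
            ENNReal.ofReal (l ^ (p - 1))) * J := by
            ring
        _ = (ENNReal.ofReal (2 * A₁) * ENNReal.ofReal (l ^ (p - 2))) * J := by
            rw [← ENNReal.ofReal_mul hA₁, ← ENNReal.ofReal_mul (by positivity),
              ← ENNReal.ofReal_mul (by positivity), show p - 1 = p - 2 + 1 by ring,
              Real.rpow_add_one hl.ne']
            congr 2
            field_simp
        _ = _ := by ring
    · set J := ∫⁻ x, if ‖f x‖ < 2 * (γ * l) then ‖f x‖ₑ ^ 2 else 0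
      calc _ = (ENNReal.ofReal A₂ * ENNReal.ofReal ((l / 2) ^ 2)⁻¹ *
              ENNReal.ofReal (l ^ (p - 1))) * J := by ring
        _ = (ENNReal.ofReal (4 * A₂) * ENNReal.ofReal (l ^ (p - 3))) * J := by
            rw [← ENNReal.ofReal_mul hA₂, ← ENNReal.ofReal_mul (by positivity),
              ← ENNReal.ofReal_mul (by positivity), show p - 1 = p - 3 + 1 + 1 by ring,
              Real.rpow_add_one hl.ne', Real.rpow_add_one hl.ne']
            congr 2
            field_simp
            norm_num
        _ = _ := by ring
  have hpow (x : E) : ENNReal.ofReal (‖f x‖ ^ p) = ‖f x‖ₑ ^ p := by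
    rw [← ENNReal.ofReal_rpow_of_nonneg (norm_nonneg _) hp0.le, ofReal_norm]
  have hc₁ : 0 ≤ ((p - 1) * γ ^ (p - 1))⁻¹ := by
    have : 0 < p - 1 := by linarith
    positivity
  have hc₂ : 0 ≤ (2 * γ) ^ (2 - p) / (2 - p) := by
    have : 0 < 2 - p := by linarith
    positivity
  have hI₁ : ∫⁻ l in Ioi (0 : ℝ), ∫⁻ x, G₁ l x ≤
      ENNReal.ofReal ((p - 1) * γ ^ (p - 1))⁻¹ * ∫⁻ x, ‖f x‖ₑ ^ p := by
    rw [lintegral_lintegral_swap hG₁m.aemeasurable,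
      ← lintegral_const_mul' _ _ ENNReal.ofReal_ne_top]
    refine lintegral_mono fun x => ?_
    rw [← hpow, ← ENNReal.ofReal_mul hc₁]
    simpa only [hG₁, ofReal_norm] using lintegral_rpow_indicator_lt hp1 hγ (norm_nonneg (f x))
  have hI₂ : ∫⁻ l in Ioi (0 : ℝ), ∫⁻ x, G₂ l x ≤
      ENNReal.ofReal ((2 * γ) ^ (2 - p) / (2 - p)) * ∫⁻ x, ‖f x‖ₑ ^ p := by
    rw [lintegral_lintegral_swap hG₂m.aemeasurable,
      ← lintegral_const_mul' _ _ ENNReal.ofReal_ne_top]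
    refine lintegral_mono fun x => ?_
    rw [← hpow, ← ENNReal.ofReal_mul hc₂]
    simpa only [hG₂, ofReal_norm] using lintegral_rpow_indicator_gt hp2 hγ (norm_nonneg (f x))
  rw [hlc, ENNReal.ofReal_mul hp0.le, ENNReal.ofReal_add (by positivity) (by positivity), mul_assoc]
  gcongr
  calc _ ≤ ∫⁻ l in Ioi (0 : ℝ), (ENNReal.ofReal (2 * A₁) * (∫⁻ x, G₁ l x) +
        ENNReal.ofReal (4 * A₂) * ∫⁻ x, G₂ l x) := setLIntegral_mono' measurableSet_Ioi hw
    _ = ENNReal.ofReal (2 * A₁) * (∫⁻ l in Ioi (0 : ℝ), ∫⁻ x, G₁ l x) +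
        ENNReal.ofReal (4 * A₂) * ∫⁻ l in Ioi (0 : ℝ), ∫⁻ x, G₂ l x := by
        rw [lintegral_add_left, lintegral_const_mul' _ _ ENNReal.ofReal_ne_top,
          lintegral_const_mul' _ _ ENNReal.ofReal_ne_top]
        exact (hG₁m.lintegral_prod_right').const_mul _
    _ ≤ _ := by
        rw [add_mul, ENNReal.ofReal_mul (p := 2 * A₁) (by positivity),
          ENNReal.ofReal_mul (p := 4 * A₂) (by positivity), mul_assoc, mul_assoc]
        gcongr

end Interpolation

section EntropyBound

variable {d : ℕ} {β0 : Ed d → ℝ}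

lemma continuous_Aj (hd : 2 ≤ d) (hβ0 : IsAdmissibleBump d β0) (j : ℕ) {t : ℝ} (ht : t ≠ 0)
    (f : SchwartzMap (Ed d) ℂ) : Continuous (Aj d β0 j t f) := by
  obtain ⟨g, hg, -⟩ := exists_schwartz_multOp
    (hasCompactSupport_comp_smul (hasCompactSupport_localMult hβ0 j) ht)
    ((contDiff_localMult hd hβ0 j).comp (contDiff_const_smul t)) f
  rw [Aj_eq_multOp, ← hg]
  exact g.continuous

lemma Aj_add (hd : 2 ≤ d) (hβ0 : IsAdmissibleBump d β0) (j : ℕ) {t : ℝ} (ht : t ≠ 0)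
    (f g : SchwartzMap (Ed d) ℂ) (x : Ed d) :
    Aj d β0 j t (f + g : SchwartzMap (Ed d) ℂ) x = Aj d β0 j t f x + Aj d β0 j t g x := by
  have hc := hasCompactSupport_comp_smul (hasCompactSupport_localMult hβ0 j) ht
  have hs := (contDiff_localMult hd hβ0 j).continuous.comp (continuous_const_smul t)
  simp only [Aj_eq_multOp, multOp, fourierInt_eq]
  rw [← integral_add (multOp_integrable hc hs f x) (multOp_integrable hc hs g x)]
  congr 1
  ext ξ
  rw [FourierTransform.fourier_add, add_apply]
  ring

lemma measurable_supAj (hd : 2 ≤ d) (hβ0 : IsAdmissibleBump d β0) (j : ℕ) {S : Set ℝ}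
    (hS : ∀ t ∈ S, t ≠ 0) (f : SchwartzMap (Ed d) ℂ) : Measurable (supAj d β0 j S f) := by
  refine LowerSemicontinuous.measurable (lowerSemicontinuous_biSup fun t ht => ?_)
  exact (continuous_Aj hd hβ0 j (hS t ht) f).enorm.lowerSemicontinuous

lemma supAj_add_le (hd : 2 ≤ d) (hβ0 : IsAdmissibleBump d β0) (j : ℕ) {S : Set ℝ}
    (hS : ∀ t ∈ S, t ≠ 0) (f g : SchwartzMap (Ed d) ℂ) (x : Ed d) :
    supAj d β0 j S (f + g : SchwartzMap (Ed d) ℂ) x ≤ supAj d β0 j S f x + supAj d β0 j S g x := by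
  refine iSup₂_le fun t ht => ?_
  rw [Aj_add hd hβ0 j (hS t ht), ← enorm_eq_nnnorm]
  refine (enorm_add_le _ _).trans (add_le_add ?_ ?_)
  · exact le_iSup₂ (f := fun t _ => (‖Aj d β0 j t f x‖₊ : ℝ≥0∞)) t ht
  · exact le_iSup₂ (f := fun t _ => (‖Aj d β0 j t g x‖₊ : ℝ≥0∞)) t ht

lemma exists_lintegral_supAj_Icc_rpow_le (hd : 2 ≤ d) (hβ0 : IsAdmissibleBump d β0) {p : ℝ}
    (hp1 : 1 ≤ p) (hp2 : p ≤ 2) :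
    ∃ C : ℝ, 0 < C ∧ ∀ (k : ℤ) (j : ℕ) (a b : ℝ), 1 ≤ j → (2 : ℝ) ^ k ≤ a → b ≤ 2 ^ (k + 1) →
      b - a ≤ (2 : ℝ) ^ (k - (j : ℤ)) → ∀ f : SchwartzMap (Ed d) ℂ,
      ∫⁻ x, supAj d β0 j (Icc a b) f x ^ p ≤
        ENNReal.ofReal (C * (((2 : ℝ) ^ j) ^ (d - 1))⁻¹ ^ (p - 1)) * ∫⁻ x, ‖f x‖ₑ ^ p := by
  obtain ⟨C₁, hC₁, h1⟩ := exists_lintegral_supAj_le hd hβ0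
  obtain ⟨C₂, hC₂, h2⟩ := exists_lintegral_supAj_sq_le hd hβ0
  rcases hp1.eq_or_lt with rfl | hp1
  · refine ⟨C₁, hC₁, fun k j a b _ hka hbk hab f => ?_⟩
    simpa using h1 k j a b hka hbk hab f
  rcases hp2.eq_or_lt with rfl | hp2
  · refine ⟨C₂, hC₂, fun k j a b hj hka _ hab f => ?_⟩
    have := h2 k j a b hj hka hab f
    simpa [show (2 : ℝ) - 1 = 1 by norm_num] using this
  have hp1' : 0 < p - 1 := by linarith
  have hp2' : 0 < 2 - p := by linarith
  refine ⟨p * (2 * C₁ * (p - 1)⁻¹ + 4 * C₂ * (2 ^ (2 - p) / (2 - p))), by positivity,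
    fun k j a b hj hka hbk hab f => ?_⟩
  have ha : 0 < a := (by positivity : (0 : ℝ) < 2 ^ k).trans_le hka
  have hS : ∀ t ∈ Icc a b, t ≠ 0 := fun t ht => (ha.trans_le ht.1).ne'
  set Q : ℝ := ((2 : ℝ) ^ j) ^ (d - 1) with hQ
  have hQ0 : 0 < Q := by positivity
  refine (lintegral_rpow_le_of_truncation (T := fun f => supAj d β0 j (Icc a b) f) (γ := Q)
    hC₁.le (by positivity : 0 ≤ C₂ * Q⁻¹) hp1 hp2 hQ0 (measurable_supAj hd hβ0 j hS)
    (supAj_add_le hd hβ0 j hS) (h1 k j a b hka hbk hab) (h2 k j a b hj hka hab) f).trans_eq ?_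
  congr 2
  have e1 : Q⁻¹ ^ (p - 1) = (Q ^ (p - 1))⁻¹ := Real.inv_rpow hQ0.le _
  have e2 : (2 * Q) ^ (2 - p) = 2 ^ (2 - p) * (Q * (Q ^ (p - 1))⁻¹) := by
    rw [Real.mul_rpow (by norm_num) hQ0.le, show 2 - p = 1 - (p - 1) by ring,
      Real.rpow_sub hQ0, Real.rpow_one, div_eq_mul_inv]
  rw [e1, e2]
  field_simp

lemma exists_cover_covN {S : Set ℝ} {δ a b : ℝ} (hδ : 0 < δ) (hS : S ⊆ Icc a b) :
    ∃ n ≤ covN S δ, ∃ c : Fin n → ℝ, S ⊆ ⋃ i, Icc (c i) (c i + δ) := by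
  have hne : {n : ℕ | ∃ c : Fin n → ℝ, S ⊆ ⋃ i, Icc (c i) (c i + δ)}.Nonempty := by
    refine ⟨⌊(b - a) / δ⌋₊ + 1, fun i => a + i * δ, fun t ht => ?_⟩
    have hat := (hS ht).1
    have h0 : 0 ≤ (t - a) / δ := div_nonneg (by linarith) hδ.le
    refine mem_iUnion.2 ⟨⟨⌊(t - a) / δ⌋₊, Nat.lt_succ_of_le (Nat.floor_le_floor ?_)⟩, ?_, ?_⟩
    · gcongr
      exact (hS ht).2
    · have := Nat.floor_le h0
      rw [le_div_iff₀ hδ] at this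
      simp only
      linarith
    · have := Nat.lt_floor_add_one ((t - a) / δ)
      rw [div_lt_iff₀ hδ] at this
      simp only
      linarith
  exact ⟨_, le_max_right _ _, Nat.sInf_mem hne⟩

lemma supAj_rpow_le_sum {p : ℝ} (hp : 0 < p) (j : ℕ) {ι : Type*} [Fintype ι] {S : Set ℝ}
    {J : ι → Set ℝ} (hS : S ⊆ ⋃ i, J i) (f : Ed d → ℂ) (x : Ed d) :
    supAj d β0 j S f x ^ p ≤ ∑ i, supAj d β0 j (J i) f x ^ p := by
  rw [← ENNReal.le_rpow_inv_iff hp]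
  refine iSup₂_le fun t ht => ?_
  obtain ⟨i, hi⟩ := mem_iUnion.1 (hS ht)
  rw [ENNReal.le_rpow_inv_iff hp]
  calc _ ≤ supAj d β0 j (J i) f x ^ p := by
        gcongr
        exact le_iSup₂ (f := fun t _ => (‖Aj d β0 j t f x‖₊ : ℝ≥0∞)) t hi
    _ ≤ _ := Finset.single_le_sum (f := fun i => supAj d β0 j (J i) f x ^ p)
        (fun _ _ => zero_le) (Finset.mem_univ i)

end EntropyBound

/-- Lemma 2.2 (i): for `𝓔 ⊆ [2^k, 2^{k+1}]`,
`‖sup_{t∈𝓔}|A_t^j f|‖_p ≲ N(𝓔,2^{k-j})^{1/p} 2^{-j(d-1)/p'} ‖f‖_p`;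
here `1/p' = 1 - 1/p`. -/
theorem Aj_sup_entropy_Lp_bound (d : ℕ) (hd : 2 ≤ d) (β0 : Ed d → ℝ)
    (hβ0 : IsAdmissibleBump d β0) (p : ℝ) (hp1 : 1 ≤ p) (hp2 : p ≤ 2) :
    ∃ C : ℝ, 0 < C ∧ ∀ (k : ℤ) (𝓔 : Set ℝ), 𝓔 ⊆ Set.Icc ((2:ℝ) ^ k) ((2:ℝ) ^ (k + 1)) →
      ∀ j : ℕ, 10 ≤ j →
      ∀ f : SchwartzMap (Ed d) ℂ,
        (∫⁻ x, (supAj d β0 j 𝓔 (⇑f) x) ^ p) ^ (1 / p) ≤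
          ENNReal.ofReal (C * (covN 𝓔 ((2:ℝ) ^ (k - (j:ℤ))) : ℝ) ^ (1 / p) *
              (2:ℝ) ^ (-(j:ℝ) * ((d:ℝ) - 1) * (1 - 1 / p))) *
            eLpNorm (⇑f) (ENNReal.ofReal p) volume := by
  obtain ⟨C, hC, hb⟩ := exists_lintegral_supAj_Icc_rpow_le hd hβ0 hp1 hp2
  have hp0 : 0 < p := by linarith
  refine ⟨C ^ (1 / p), by positivity, fun k 𝓔 h𝓔 j hj f => ?_⟩
  set δ : ℝ := (2 : ℝ) ^ (k - (j : ℤ))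
  have hδ : 0 < δ := by positivity
  obtain ⟨n, hn, c, hc⟩ := exists_cover_covN hδ h𝓔
  set N := covN 𝓔 δ
  set lo : Fin n → ℝ := fun i => max (c i) (2 ^ k)
  set hi : Fin n → ℝ := fun i => min (c i + δ) (2 ^ (k + 1))
  have hcov : 𝓔 ⊆ ⋃ i, Icc (lo i) (hi i) := by
    intro t ht
    obtain ⟨i, hi⟩ := mem_iUnion.1 (hc ht)
    exact mem_iUnion.2 ⟨i, max_le hi.1 (h𝓔 ht).1, le_min hi.2 (h𝓔 ht).2⟩
  have hlo (i : Fin n) : (2 : ℝ) ^ k ≤ lo i := le_max_right _ _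
  have hpos (i : Fin n) : ∀ t ∈ Icc (lo i) (hi i), t ≠ 0 := fun t ht =>
    (((by positivity : (0 : ℝ) < 2 ^ k).trans_le (hlo i)).trans_le ht.1).ne'
  set D : ℝ := (((2 : ℝ) ^ j) ^ (d - 1))⁻¹ with hD
  have hD0 : 0 < D := by positivity
  set F := ∫⁻ x, ‖f x‖ₑ ^ p with hF
  have hmain : ∫⁻ x, supAj d β0 j 𝓔 f x ^ p ≤ ENNReal.ofReal (N * (C * D ^ (p - 1))) * F := by
    calc _ ≤ ∫⁻ x, ∑ i, supAj d β0 j (Icc (lo i) (hi i)) f x ^ p :=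
          lintegral_mono fun x => supAj_rpow_le_sum hp0 j hcov f x
      _ = ∑ i, ∫⁻ x, supAj d β0 j (Icc (lo i) (hi i)) f x ^ p :=
          lintegral_finsetSum _ fun i _ => (measurable_supAj hd hβ0 j (hpos i) f).pow_const p
      _ ≤ ∑ _i : Fin n, ENNReal.ofReal (C * D ^ (p - 1)) * F := by
          refine Finset.sum_le_sum fun i _ => hb k j _ _ (by omega) (hlo i) (min_le_right _ _) ?_ f
          have h1 : hi i ≤ c i + δ := min_le_left _ _
          have h2 : c i ≤ lo i := le_max_left _ _
          linarith
      _ = n * (ENNReal.ofReal (C * D ^ (p - 1)) * F) := by simp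
      _ ≤ N * (ENNReal.ofReal (C * D ^ (p - 1)) * F) := by gcongr
      _ = _ := by
          rw [ENNReal.ofReal_mul (Nat.cast_nonneg _), ENNReal.ofReal_natCast, mul_assoc]
  have hDp : (D ^ (p - 1)) ^ (1 / p) = (2 : ℝ) ^ (-(j : ℝ) * ((d : ℝ) - 1) * (1 - 1 / p)) := by
    have e : D = (2 : ℝ) ^ (-(j : ℝ) * ((d : ℝ) - 1)) := by
      rw [hD, ← pow_mul, ← Real.rpow_natCast, ← Real.rpow_neg (by norm_num)]
      push_cast [Nat.cast_sub (by omega : 1 ≤ d)]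
      ring_nf
    rw [e, ← Real.rpow_mul (by positivity), ← Real.rpow_mul (by positivity)]
    congr 1
    field_simp
  rw [eLpNorm_eq_lintegral_rpow_enorm_toReal (by simpa using hp0) ENNReal.ofReal_ne_top,
    ENNReal.toReal_ofReal hp0.le, ← hF]
  calc _ ≤ (ENNReal.ofReal (N * (C * D ^ (p - 1))) * F) ^ (1 / p) := by gcongr
    _ = _ := by
      rw [ENNReal.mul_rpow_of_nonneg _ _ (by positivity),
        ENNReal.ofReal_rpow_of_nonneg (by positivity) (by positivity),
        Real.mul_rpow (by positivity) (by positivity), Real.mul_rpow hC.le (by positivity), hDp]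
      congr 2
      ring
end
end

section
/- Let d ≥ 2 and p_d = d/(d−1). Suppose E ⊆ (0,∞) satisfies the regularity hypothesis (R̃_{p_d}) with collections 𝒥^k and subfamilies 𝒥^k_μ as in its definition, and suppose condition (C̃_{p_d}) holds: sup over all intervals I ⊆ ℝ with |I| ≥ 1 of |I|^{−1} ∑_{k∈I∩ℤ} ∑_{n∈ℤ, 0<n≤|I|} N(E^k, 2^{k−n}) 2^{−n} n^{1/(d−1)} < ∞. Then the measure ∑_{k∈ℤ} ∑_{μ≥0} (∑_{J∈𝒥^k_μ} card(J)) 2^{−μ} (1+μ)^{d/(d−1)} δ_{(k,μ)} is also a Carleson measure; that is, sup over all intervals I ⊆ ℝ with |I| ≥ 1 of |I|^{−1} ∑_{k∈I∩ℤ} ∑_{0≤μ≤|I|} (∑_{J∈𝒥^k_μ} card(J)) 2^{−μ} (1+μ)^{d/(d−1)} < ∞. -/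
open MeasureTheory Metric Set Filter
open scoped ENNReal NNReal Topology

noncomputable section

/-- Spherical mean `A_t f`. -/
def sphMean (d : ℕ) (t : ℝ) (f : Ed d → ℂ) (x : Ed d) : ℂ :=
  ∫ y : sphere (0 : Ed d) 1, f (x - t • (y : Ed d)) ∂(sphereProb d)

/-- Spherical maximal function, with values in `ℝ≥0∞`. -/
def maxFn (d : ℕ) (E : Set ℝ) (f : Ed d → ℂ) (x : Ed d) : ℝ≥0∞ :=
  ⨆ t ∈ E, (‖sphMean d t f x‖₊ : ℝ≥0∞)

def Ek (E : Set ℝ) (k : ℤ) : Set ℝ := E ∩ Set.Ico ((2:ℝ)^k) ((2:ℝ)^(k+1))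

/-- weak type (p,p) for the spherical maximal operator. -/
def WeakTypePP (d : ℕ) (E : Set ℝ) (p : ℝ) : Prop :=
  ∃ C : ℝ, ∀ f : Ed d → ℂ, Continuous f → HasCompactSupport f → ∀ a : ℝ, 0 < a →
    volume {x | ENNReal.ofReal a < maxFn d E f x} ≤
      ENNReal.ofReal (C * a ^ (-p) * ∫ x, ‖f x‖ ^ p)

/-- `J` is equally spaced with width `δ` and possible deviation `C`. -/
def EquallySpaced (J : Set ℝ) (δ C : ℝ) : Prop :=
  ∀ t ∈ J, C⁻¹ * δ ≤ infDist t (J \ {t}) ∧ infDist t (J \ {t}) ≤ C * δ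

/-- The set of endpoints `𝒟^k` of a family of sets. -/
def Dk (𝒥 : ℤ → Set (Set ℝ)) (k : ℤ) : Set ℝ := ⋃ J ∈ 𝒥 k, {sInf J, sSup J}

/-- `𝒥^k_μ`: the members of `𝒥^k` which are equally spaced with width `2^{k-μ}`
and possible deviation `C`. -/
def Jmu (𝒥 : ℤ → Set (Set ℝ)) (C : ℝ) (k : ℤ) (μ : ℕ) : Set (Set ℝ) :=
  {J ∈ 𝒥 k | EquallySpaced J ((2:ℝ) ^ (k - (μ:ℤ))) C}

/-- Conditions (a) and (b) of the regularity hypotheses `(R_p)` and `(R̃_p)`. -/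
def RegFamilyCore (E : Set ℝ) (d : ℕ) (p : ℝ) (𝒥 : ℤ → Set (Set ℝ)) (C : ℝ) : Prop :=
  1 < C ∧
  (∀ k : ℤ, ∀ J ∈ 𝒥 k, J ⊆ Set.Icc ((2:ℝ)^k) ((2:ℝ)^(k+1))) ∧
  (∀ k : ℤ, Ek E k ⊆ ⋃ J ∈ 𝒥 k, J) ∧
  (∀ k : ℤ, ∀ J ∈ 𝒥 k, ∃ δ : ℝ, 0 < δ ∧ EquallySpaced J δ C) ∧
  (∃ ω : ℕ → ℝ, (∀ j, 0 < ω j) ∧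
    (∑' j : ℕ, ENNReal.ofReal ((ω j) ^ (-(p / (p - 1))))) ≤ 1 ∧
    ∃ C0 : ℝ, ∀ k : ℤ,
      (∑' j : ℕ, ENNReal.ofReal ((ω j) ^ p) * (covN (Dk 𝒥 (k + j)) ((2:ℝ) ^ k) : ℝ≥0∞) *
          ENNReal.ofReal ((2:ℝ) ^ (-(j:ℝ) * ((d:ℝ) - 1) * (p - 1)))) ≤ ENNReal.ofReal C0)

/-- Condition (c) of the regularity hypothesis `(R_p)`. -/
def CardCond (E : Set ℝ) (𝒥 : ℤ → Set (Set ℝ)) (C : ℝ) : Prop :=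
  ∃ C1 : ℝ, 1 < C1 ∧ ∀ k : ℤ, ∀ μ : ℕ,
    (∑' J : (Jmu 𝒥 C k μ), ((J : Set ℝ).ncard : ℝ≥0∞)) ≤
      ENNReal.ofReal C1 * (covN (Ek E k) ((2:ℝ) ^ (k - (μ:ℤ))) : ℝ≥0∞)

/-- Condition (c̃) of the regularity hypothesis `(R̃_{p_d})`. -/
def CardCondTilde (E : Set ℝ) (𝒥 : ℤ → Set (Set ℝ)) (C : ℝ) : Prop :=
  ∃ C1 : ℝ, 1 < C1 ∧ ∀ k : ℤ, ∀ n : ℕ,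
    (∑' μ : {μ : ℕ // n ≤ μ},
        ENNReal.ofReal ((2:ℝ) ^ (-(μ.1:ℝ))) *
          ∑' J : (Jmu 𝒥 C k μ.1), ((J : Set ℝ).ncard : ℝ≥0∞)) ≤
      ENNReal.ofReal (C1 * (2:ℝ) ^ (-(n:ℝ))) * (covN (Ek E k) ((2:ℝ) ^ (k - (n:ℤ))) : ℝ≥0∞)

/-- The regularity hypothesis `(R_p)`. -/
def RegHyp (E : Set ℝ) (d : ℕ) (p : ℝ) : Prop :=
  ∃ (𝒥 : ℤ → Set (Set ℝ)) (C : ℝ), RegFamilyCore E d p 𝒥 C ∧ CardCond E 𝒥 C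

/-- The regularity hypothesis `(R̃_{p_d})`. -/
def RegHypTilde (E : Set ℝ) (d : ℕ) (p : ℝ) : Prop :=
  ∃ (𝒥 : ℤ → Set (Set ℝ)) (C : ℝ), RegFamilyCore E d p 𝒥 C ∧ CardCondTilde E 𝒥 C

/-- Condition `(C̃_{p_d})` (Carleson measure condition). -/
def CondCarleson (E : Set ℝ) (d : ℕ) : Prop :=
  ∃ B : ℝ, ∀ a b : ℝ, 1 ≤ b - a →
    (∑' k : {k : ℤ // a ≤ (k:ℝ) ∧ (k:ℝ) ≤ b},
      ∑' n : {n : ℤ // 0 < n ∧ (n:ℝ) ≤ b - a},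
        (covN (Ek E k.1) ((2:ℝ) ^ (k.1 - n.1)) : ℝ≥0∞) *
          ENNReal.ofReal ((2:ℝ) ^ (-(n.1:ℝ)) * (n.1:ℝ) ^ (1 / ((d:ℝ) - 1)))) ≤
      ENNReal.ofReal (B * (b - a))

/-- A discrete substitute for `(1 + m) ^ (1 + e) ≲ 1 + ∫₁ᵐ x ^ e`. -/
lemma one_add_rpow_le_sum_rpow {e : ℝ} (he1 : e ≤ 1) (m : ℕ) :
    (1 + (m : ℝ)) ^ (1 + e) ≤ 1 + 3 * ∑ n ∈ Finset.Icc 1 m, (n : ℝ) ^ e := by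
  induction m with
  | zero => simp
  | succ m ih =>
    rw [Finset.sum_Icc_succ_top (by omega)]
    set x : ℝ := ((m + 1 : ℕ) : ℝ) with hx
    have hx1 : 1 ≤ x := by rw [hx]; push_cast; linarith [Nat.cast_nonneg (α := ℝ) m]
    have hx0 : 0 < x := by linarith
    have ih' : x ^ e * x ≤ 1 + 3 * ∑ n ∈ Finset.Icc 1 m, (n : ℝ) ^ e := by
      rw [show x ^ e * x = (1 + (m : ℝ)) ^ (1 + e) by
        rw [show 1 + (m : ℝ) = x by rw [hx]; push_cast; ring, Real.rpow_add hx0,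
          Real.rpow_one, mul_comm]]
      exact ih
    have hinv : x⁻¹ ≤ 1 := inv_le_one_of_one_le₀ hx1
    have hpow : (1 + x) ^ e ≤ x ^ e * (1 + x⁻¹) := by
      rw [show 1 + x = x * (1 + x⁻¹) by field_simp; ring, Real.mul_rpow hx0.le (by positivity)]
      gcongr
      calc (1 + x⁻¹) ^ e ≤ (1 + x⁻¹) ^ (1 : ℝ) :=
            Real.rpow_le_rpow_of_exponent_le (by linarith [inv_pos.2 hx0]) he1
        _ = 1 + x⁻¹ := Real.rpow_one _
    have hstep : (1 + x⁻¹) * (1 + x) ≤ x + 3 := by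
      have : x⁻¹ * x = 1 := inv_mul_cancel₀ hx0.ne'
      nlinarith
    calc (1 + x) ^ (1 + e) = (1 + x) ^ e * (1 + x) := by
          rw [Real.rpow_add (by linarith), Real.rpow_one, mul_comm]
      _ ≤ x ^ e * (1 + x⁻¹) * (1 + x) := by gcongr
      _ = x ^ e * ((1 + x⁻¹) * (1 + x)) := by ring
      _ ≤ x ^ e * (x + 3) := by gcongr
      _ ≤ _ := by linarith

/-- Summation by parts: bounds on the weighted tails of `A` bound its weighted partial sums. -/
lemma sum_weighted_le_of_tail_le {e c : ℝ} (he1 : e ≤ 1) (hc : 0 ≤ c)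
    {A N : ℕ → ℝ≥0∞}
    (h : ∀ n : ℕ, (∑' μ : {μ : ℕ // n ≤ μ}, ENNReal.ofReal ((2:ℝ) ^ (-(μ.1:ℝ))) * A μ.1) ≤
      ENNReal.ofReal (c * (2:ℝ) ^ (-(n:ℝ))) * N n) (m : ℕ) :
    ∑ μ ∈ Finset.range (m + 1),
        A μ * ENNReal.ofReal ((2:ℝ) ^ (-(μ:ℝ)) * (1 + (μ:ℝ)) ^ (1 + e)) ≤
      ENNReal.ofReal c * (N 0 + 3 * ∑ n ∈ Finset.Icc 1 m,
        N n * ENNReal.ofReal ((2:ℝ) ^ (-(n:ℝ)) * (n:ℝ) ^ e)) := by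
  set a : ℕ → ℝ≥0∞ := fun μ => ENNReal.ofReal ((2:ℝ) ^ (-(μ:ℝ))) * A μ with ha
  have tail : ∀ (n : ℕ) (s : Finset ℕ), (∀ μ ∈ s, n ≤ μ) →
      ∑ μ ∈ s, a μ ≤ ENNReal.ofReal c * (ENNReal.ofReal ((2:ℝ) ^ (-(n:ℝ))) * N n) := by
    intro n s hs
    calc ∑ μ ∈ s, a μ = ∑ μ ∈ s, {μ | n ≤ μ}.indicator a μ :=
          Finset.sum_congr rfl fun μ hμ =>
            (Set.indicator_of_mem (show μ ∈ {μ | n ≤ μ} from hs μ hμ) a).symm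
      _ ≤ ∑' μ, {μ | n ≤ μ}.indicator a μ := ENNReal.sum_le_tsum s
      _ = ∑' μ : {μ : ℕ // n ≤ μ}, a μ.1 := (tsum_subtype {μ | n ≤ μ} a).symm
      _ ≤ _ := h n
      _ = _ := by rw [ENNReal.ofReal_mul hc, mul_assoc]
  have pointwise : ∀ μ : ℕ,
      A μ * ENNReal.ofReal ((2:ℝ) ^ (-(μ:ℝ)) * (1 + (μ:ℝ)) ^ (1 + e)) ≤
        a μ + 3 * ∑ n ∈ Finset.Icc 1 μ, ENNReal.ofReal ((n:ℝ) ^ e) * a μ := by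
    intro μ
    have hpos : ∀ n ∈ Finset.Icc 1 μ, 0 ≤ (n : ℝ) ^ e := fun n _ => by positivity
    calc A μ * ENNReal.ofReal ((2:ℝ) ^ (-(μ:ℝ)) * (1 + (μ:ℝ)) ^ (1 + e))
        = ENNReal.ofReal ((1 + (μ:ℝ)) ^ (1 + e)) * a μ := by
          rw [ENNReal.ofReal_mul (by positivity), ha]; ring
      _ ≤ ENNReal.ofReal (1 + 3 * ∑ n ∈ Finset.Icc 1 μ, (n : ℝ) ^ e) * a μ := by
          gcongr
          exact one_add_rpow_le_sum_rpow he1 μ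
      _ = _ := by
          rw [ENNReal.ofReal_add zero_le_one
            (mul_nonneg (by norm_num) (Finset.sum_nonneg hpos)),
            ENNReal.ofReal_mul (by norm_num), ENNReal.ofReal_sum_of_nonneg hpos,
            ← Finset.sum_mul, ENNReal.ofReal_one,
            show ENNReal.ofReal 3 = 3 from ENNReal.ofReal_ofNat 3]
          ring
  have head : ∑ μ ∈ Finset.range (m + 1), a μ ≤ ENNReal.ofReal c * N 0 := by
    simpa using tail 0 (Finset.range (m + 1)) fun μ _ => Nat.zero_le μ
  have double : ∑ μ ∈ Finset.range (m + 1), ∑ n ∈ Finset.Icc 1 μ,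
      ENNReal.ofReal ((n:ℝ) ^ e) * a μ ≤ ENNReal.ofReal c * ∑ n ∈ Finset.Icc 1 m,
        N n * ENNReal.ofReal ((2:ℝ) ^ (-(n:ℝ)) * (n:ℝ) ^ e) := by
    rw [Finset.sum_comm' (t' := Finset.Icc 1 m) (s' := fun n => Finset.Icc n m)
      (by intro x y; simp only [Finset.mem_range, Finset.mem_Icc]; omega), Finset.mul_sum]
    refine Finset.sum_le_sum fun n _ => ?_
    rw [← Finset.mul_sum]
    calc ENNReal.ofReal ((n:ℝ) ^ e) * ∑ μ ∈ Finset.Icc n m, a μ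
        ≤ ENNReal.ofReal ((n:ℝ) ^ e) *
            (ENNReal.ofReal c * (ENNReal.ofReal ((2:ℝ) ^ (-(n:ℝ))) * N n)) := by
          gcongr
          exact tail n _ fun μ hμ => (Finset.mem_Icc.1 hμ).1
      _ = _ := by rw [ENNReal.ofReal_mul (by positivity)]; ring
  calc _ ≤ ∑ μ ∈ Finset.range (m + 1),
        (a μ + 3 * ∑ n ∈ Finset.Icc 1 μ, ENNReal.ofReal ((n:ℝ) ^ e) * a μ) :=
        Finset.sum_le_sum fun μ _ => pointwise μ
    _ = ∑ μ ∈ Finset.range (m + 1), a μ + 3 * ∑ μ ∈ Finset.range (m + 1),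
          ∑ n ∈ Finset.Icc 1 μ, ENNReal.ofReal ((n:ℝ) ^ e) * a μ := by
        rw [Finset.sum_add_distrib, ← Finset.mul_sum]
    _ ≤ ENNReal.ofReal c * N 0 + 3 * (ENNReal.ofReal c * ∑ n ∈ Finset.Icc 1 m,
          N n * ENNReal.ofReal ((2:ℝ) ^ (-(n:ℝ)) * (n:ℝ) ^ e)) := by gcongr
    _ = _ := by ring

lemma one_le_covN (S : Set ℝ) (δ : ℝ) : 1 ≤ covN S δ := le_max_left _ _

lemma covN_Ek_self (E : Set ℝ) (k : ℤ) : covN (Ek E k) ((2:ℝ) ^ k) = 1 := by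
  refine max_eq_left (Nat.sInf_le ⟨fun _ => (2:ℝ) ^ k, fun x hx => ?_⟩)
  have hx' := hx.2
  rw [zpow_add_one₀ two_ne_zero] at hx'
  exact Set.mem_iUnion.2 ⟨0, hx'.1, by linarith [hx'.2]⟩

lemma tsum_nat_le_eq_sum_range {L : ℝ} (hL : 0 ≤ L) (f : ℕ → ℝ≥0∞) :
    ∑' μ : {μ : ℕ // (μ:ℝ) ≤ L}, f μ.1 = ∑ μ ∈ Finset.range (⌊L⌋₊ + 1), f μ := by
  have hs : {μ : ℕ | (μ:ℝ) ≤ L} = (Finset.range (⌊L⌋₊ + 1) : Set ℕ) := by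
    ext μ
    simp [Nat.le_floor_iff hL]
  change ∑' μ : {μ : ℕ | (μ:ℝ) ≤ L}, f μ.1 = _
  rw [hs, Finset.tsum_subtype']

lemma sum_Icc_le_tsum_int {L : ℝ} (hL : 0 ≤ L) (g : ℤ → ℝ≥0∞) :
    ∑ n ∈ Finset.Icc 1 ⌊L⌋₊, g n ≤ ∑' n : {n : ℤ // 0 < n ∧ (n:ℝ) ≤ L}, g n.1 := by
  rw [← Finset.tsum_subtype]
  let i : (Finset.Icc 1 ⌊L⌋₊) → {n : ℤ // 0 < n ∧ (n:ℝ) ≤ L} := fun n =>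
    ⟨(n.1 : ℤ), by
      have h := Finset.mem_Icc.1 n.2
      refine ⟨by omega, ?_⟩
      exact_mod_cast (Nat.le_floor_iff hL).1 h.2⟩
  have hi : Function.Injective i := fun x y hxy =>
    Subtype.ext (Int.ofNat_inj.1 (congrArg Subtype.val hxy))
  exact ENNReal.tsum_comp_le_tsum_of_injective hi fun n => g n.1

/-- Lemma 6.1: under `(R̃_{p_d})` and the Carleson condition `(C̃_{p_d})`, the measure
`∑_{k,μ} (∑_{J ∈ 𝒥^k_μ} card J) 2^{-μ} (1+μ)^{d/(d-1)} δ_{(k,μ)}` is also a Carleson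
measure. -/
theorem carleson_measure_of_regular_family (d : ℕ) (hd : 2 ≤ d)
    (E : Set ℝ) (hE : E ⊆ Set.Ioi (0:ℝ))
    (𝒥 : ℤ → Set (Set ℝ)) (C : ℝ)
    (hcore : RegFamilyCore E d ((d:ℝ) / ((d:ℝ) - 1)) 𝒥 C)
    (hcard : CardCondTilde E 𝒥 C)
    (hCarl : CondCarleson E d) :
    ∃ B : ℝ, ∀ a b : ℝ, 1 ≤ b - a →
      (∑' k : {k : ℤ // a ≤ (k:ℝ) ∧ (k:ℝ) ≤ b},
        ∑' μ : {μ : ℕ // (μ:ℝ) ≤ b - a},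
          (∑' J : (Jmu 𝒥 C k.1 μ.1), ((J : Set ℝ).ncard : ℝ≥0∞)) *
            ENNReal.ofReal ((2:ℝ) ^ (-(μ.1:ℝ)) * (1 + (μ.1:ℝ)) ^ ((d:ℝ) / ((d:ℝ) - 1)))) ≤
        ENNReal.ofReal (B * (b - a)) := by
  obtain ⟨C1, hC1, hcard⟩ := hcard
  obtain ⟨B, hB⟩ := hCarl
  have hC0 : 0 ≤ C1 := by linarith
  have hd1 : 1 ≤ (d:ℝ) - 1 := by
    have : (2:ℝ) ≤ d := by exact_mod_cast hd
    linarith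
  have he1 : 1 / ((d:ℝ) - 1) ≤ 1 := (div_le_one (by linarith)).2 hd1
  have hexp : (d:ℝ) / ((d:ℝ) - 1) = 1 + 1 / ((d:ℝ) - 1) := by
    have : (d:ℝ) - 1 ≠ 0 := by linarith
    field_simp
    ring
  rw [hexp]
  set e : ℝ := 1 / ((d:ℝ) - 1)
  refine ⟨C1 * 5 * B, fun a b hab => ?_⟩
  have hL : 0 ≤ b - a := by linarith
  have hfloor : 1 ≤ ⌊b - a⌋₊ := (Nat.le_floor_iff hL).2 (by simpa using hab)
  rw [mul_assoc, ENNReal.ofReal_mul (by positivity)]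
  refine le_trans ?_ (mul_le_mul_right (hB a b hab) _)
  rw [← ENNReal.tsum_mul_left]
  refine ENNReal.tsum_le_tsum fun k => ?_
  rw [tsum_nat_le_eq_sum_range hL fun μ =>
    (∑' J : (Jmu 𝒥 C k.1 μ), ((J : Set ℝ).ncard : ℝ≥0∞)) *
      ENNReal.ofReal ((2:ℝ) ^ (-(μ:ℝ)) * (1 + (μ:ℝ)) ^ (1 + e))]
  refine (sum_weighted_le_of_tail_le he1 hC0
    (N := fun n => (covN (Ek E k.1) ((2:ℝ) ^ (k.1 - (n:ℤ))) : ℝ≥0∞)) (hcard k.1) _).trans ?_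
  have hT := sum_Icc_le_tsum_int hL fun n : ℤ =>
    (covN (Ek E k.1) ((2:ℝ) ^ (k.1 - n)) : ℝ≥0∞) *
      ENNReal.ofReal ((2:ℝ) ^ (-(n:ℝ)) * (n:ℝ) ^ e)
  simp only [Int.cast_natCast] at hT
  set S := ∑ n ∈ Finset.Icc 1 ⌊b - a⌋₊, (covN (Ek E k.1) ((2:ℝ) ^ (k.1 - (n:ℤ))) : ℝ≥0∞) *
    ENNReal.ofReal ((2:ℝ) ^ (-(n:ℝ)) * (n:ℝ) ^ e) with hS
  have hhead : (covN (Ek E k.1) ((2:ℝ) ^ (k.1 - ((0:ℕ):ℤ))) : ℝ≥0∞) ≤ 2 * S := by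
    have hone : ENNReal.ofReal ((2:ℝ) ^ (-((1:ℕ):ℝ)) * ((1:ℕ):ℝ) ^ e) ≤ S := by
      refine le_trans ?_ (Finset.single_le_sum (fun _ _ => zero_le)
        (Finset.mem_Icc.2 ⟨le_rfl, hfloor⟩))
      exact le_mul_of_one_le_left zero_le (by exact_mod_cast one_le_covN _ _)
    rw [Nat.cast_zero, sub_zero, covN_Ek_self]
    calc ((1:ℕ) : ℝ≥0∞)
        = ENNReal.ofReal 2 * ENNReal.ofReal ((2:ℝ) ^ (-((1:ℕ):ℝ)) * ((1:ℕ):ℝ) ^ e) := by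
          rw [← ENNReal.ofReal_mul zero_le_two, Nat.cast_one, Nat.cast_one, Real.one_rpow,
            Real.rpow_neg_one]
          norm_num
      _ ≤ 2 * S := by
          rw [show ENNReal.ofReal 2 = 2 from ENNReal.ofReal_ofNat 2]
          gcongr
  rw [ENNReal.ofReal_mul hC0, show ENNReal.ofReal 5 = 5 from ENNReal.ofReal_ofNat 5, mul_assoc]
  gcongr
  calc _ ≤ 2 * S + 3 * S := by gcongr
    _ = 5 * S := by ring
    _ ≤ _ := by gcongr
end
end

section
/- Let d ≥ 2 and p_d = d/(d−1). Suppose E ⊆ (0,∞) satisfies the regularity hypothesis (R̃_{p_d}) with collections 𝒥^k and subfamilies 𝒥^k_μ as in its definition, and suppose condition (C̃_{p_d}) holds: sup over all intervals I ⊆ ℝ with |I| ≥ 1 of |I|^{−1} ∑_{k∈I∩ℤ} ∑_{n∈ℤ, 0<n≤|I|} N(E^k, 2^{k−n}) 2^{−n} n^{1/(d−1)} < ∞. Then there is a constant C such that sup_{ν∈ℤ} ∑_{μ≥0} (∑_{J∈𝒥^{μ+ν}_μ} card(J)) 2^{−μ} ≤ C. -/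
open MeasureTheory Metric Set Filter
open scoped ENNReal NNReal Topology

noncomputable section

theorem sum_le_tsum_subtype_of_injective {ι κ : Type*} {P : κ → Prop} (f : κ → ℝ≥0∞)
    (g : ι → κ) (hg : Function.Injective g) (s : Finset ι) (hs : ∀ i ∈ s, P (g i)) :
    ∑ i ∈ s, f (g i) ≤ ∑' k : {k // P k}, f k.1 := by
  rw [← Finset.tsum_subtype s (fun i => f (g i))]
  refine ENNReal.tsum_comp_le_tsum_of_injective
    (f := fun i : {i // i ∈ s} => (⟨g i.1, hs i.1 i.2⟩ : {k // P k})) ?_ (fun k => f k.1)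
  intro i j hij
  exact Subtype.ext (hg (congrArg Subtype.val hij))

theorem half_mul_half_rpow_le_sum_rpow {s : ℝ} (hs : 0 ≤ s) (N : ℕ) :
    (N / 2 : ℝ) * (N / 2 : ℝ) ^ s ≤ ∑ n ∈ Finset.Icc 1 N, (n : ℝ) ^ s := by
  rcases Nat.eq_zero_or_pos N with rfl | hN
  · simp
  have hsub : Finset.Icc ((N + 1) / 2) N ⊆ Finset.Icc 1 N :=
    Finset.Icc_subset_Icc (by omega) le_rfl
  refine le_trans ?_ (Finset.sum_le_sum_of_subset_of_nonneg hsub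
    fun n _ _ => Real.rpow_nonneg n.cast_nonneg s)
  have hterm : ∀ n ∈ Finset.Icc ((N + 1) / 2) N, (N / 2 : ℝ) ^ s ≤ (n : ℝ) ^ s := by
    intro n hn
    rw [Finset.mem_Icc] at hn
    have h : N ≤ n * 2 := by omega
    have h' : (N : ℝ) ≤ n * 2 := by exact_mod_cast h
    exact Real.rpow_le_rpow (by positivity) (by linarith) hs
  refine le_trans ?_ (Finset.card_nsmul_le_sum _ _ _ hterm)
  rw [nsmul_eq_mul, Nat.card_Icc]
  have h : N ≤ (N + 1 - (N + 1) / 2) * 2 := by omega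
  have h' : (N : ℝ) ≤ ((N + 1 - (N + 1) / 2 : ℕ) : ℝ) * 2 := by exact_mod_cast h
  exact mul_le_mul_of_nonneg_right (by linarith) (by positivity)

theorem covN_le_one_of_subset_Icc {S : Set ℝ} {c δ : ℝ} (h : S ⊆ Set.Icc c (c + δ)) :
    covN S δ ≤ 1 := by
  refine max_le le_rfl (Nat.sInf_le ⟨fun _ => c, ?_⟩)
  exact h.trans (Set.subset_iUnion (fun _ : Fin 1 => Set.Icc c (c + δ)) 0)

/-- If `2^{-n} N(E^k, 2^{k-n})` dominates the tails `T k n`, which decrease in `n`, then the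
Carleson condition bounds the sum of `T k N` over a block of `N` consecutive `k`. -/
theorem sum_tail_le_of_condCarleson {E : Set ℝ} {d : ℕ} (hd : 2 ≤ d) (hCarl : CondCarleson E d)
    {T : ℤ → ℕ → ℝ≥0∞} (hT : ∀ k, Antitone (T k)) {C₁ : ℝ}
    (hTle : ∀ k n, T k n ≤ ENNReal.ofReal (C₁ * (2:ℝ) ^ (-(n:ℝ))) *
      (covN (Ek E k) ((2:ℝ) ^ (k - (n:ℤ))) : ℝ≥0∞)) (hC₁ : 0 ≤ C₁) :
    ∃ D : ℝ, 0 ≤ D ∧ ∀ (ν : ℤ) (N : ℕ), 1 ≤ N →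
      ∑ μ ∈ Finset.Ico N (2 * N), T ((μ:ℤ) + ν) N ≤
        ENNReal.ofReal (D * (N:ℝ) ^ (-(1 / ((d:ℝ) - 1)))) := by
  obtain ⟨B, hB⟩ := hCarl
  set s : ℝ := 1 / ((d:ℝ) - 1) with hs_def
  have hd' : (2:ℝ) ≤ d := by exact_mod_cast hd
  have hs : 0 ≤ s := by rw [hs_def]; exact div_nonneg zero_le_one (by linarith)
  refine ⟨C₁ * |B| * (2 * 2 ^ s), by positivity, fun ν N hN => ?_⟩
  have hN0 : (0:ℝ) < N := by exact_mod_cast hN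
  have hN1 : (1:ℝ) ≤ N := by exact_mod_cast hN
  set F : ℤ → ℤ → ℝ≥0∞ := fun k n =>
    (covN (Ek E k) ((2:ℝ) ^ (k - n)) : ℝ≥0∞) *
      ENNReal.ofReal ((2:ℝ) ^ (-(n:ℝ)) * (n:ℝ) ^ s) with hF
  have hTF : ∀ (k : ℤ) (n : ℕ), T k n * ENNReal.ofReal ((n:ℝ) ^ s) ≤
      ENNReal.ofReal C₁ * F k n := by
    intro k n
    refine (mul_le_mul_left (hTle k n) _).trans (le_of_eq ?_)
    simp only [hF, Int.cast_natCast]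
    rw [ENNReal.ofReal_mul hC₁, ENNReal.ofReal_mul (by positivity)]
    ring
  have hcarl : ∑ μ ∈ Finset.Ico N (2 * N), ∑ n ∈ Finset.Icc 1 N, F ((μ:ℤ) + ν) (n:ℤ) ≤
      ENNReal.ofReal (B * N) := by
    have hb := hB ((N:ℝ) + ν) (2 * (N:ℝ) + ν) (by linarith)
    have hlen : (2 * (N:ℝ) + ν) - ((N:ℝ) + ν) = N := by ring
    rw [hlen] at hb
    refine le_trans ?_ hb
    refine le_trans (Finset.sum_le_sum fun μ _ =>
      sum_le_tsum_subtype_of_injective (P := fun n : ℤ => 0 < n ∧ (n:ℝ) ≤ N)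
        (F ((μ:ℤ) + ν)) (fun n : ℕ => (n:ℤ)) Nat.cast_injective _ ?_) ?_
    · intro n hn
      rw [Finset.mem_Icc] at hn
      refine ⟨by omega, ?_⟩
      exact_mod_cast hn.2
    · refine sum_le_tsum_subtype_of_injective
        (P := fun k : ℤ => (N:ℝ) + ν ≤ k ∧ (k:ℝ) ≤ 2 * (N:ℝ) + ν)
        (fun k : ℤ => ∑' n : {n : ℤ // 0 < n ∧ (n:ℝ) ≤ N}, F k n.1)
        (fun μ : ℕ => (μ:ℤ) + ν) ?_ _ ?_
      · intro i j hij
        simpa using hij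
      · intro μ hμ
        rw [Finset.mem_Ico] at hμ
        have h1 : (N:ℝ) ≤ μ := by exact_mod_cast hμ.1
        have h2 : (μ:ℝ) ≤ 2 * N := by exact_mod_cast hμ.2.le
        push_cast
        exact ⟨by linarith, by linarith⟩
  set X := ∑ μ ∈ Finset.Ico N (2 * N), T ((μ:ℤ) + ν) N with hX
  set w : ℝ := (N / 2 : ℝ) * (N / 2 : ℝ) ^ s with hw
  have hw0 : 0 < w := by positivity
  have hXw : X * ENNReal.ofReal w ≤ ENNReal.ofReal C₁ * ENNReal.ofReal (|B| * N) := by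
    calc X * ENNReal.ofReal w
        ≤ X * ∑ n ∈ Finset.Icc 1 N, ENNReal.ofReal ((n:ℝ) ^ s) := by
          rw [← ENNReal.ofReal_sum_of_nonneg
            (fun n _ => Real.rpow_nonneg n.cast_nonneg s)]
          gcongr
          exact half_mul_half_rpow_le_sum_rpow hs N
      _ = ∑ μ ∈ Finset.Ico N (2 * N), ∑ n ∈ Finset.Icc 1 N,
            T ((μ:ℤ) + ν) N * ENNReal.ofReal ((n:ℝ) ^ s) := by
          rw [hX, Finset.sum_mul_sum]
      _ ≤ ∑ μ ∈ Finset.Ico N (2 * N), ∑ n ∈ Finset.Icc 1 N,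
            ENNReal.ofReal C₁ * F ((μ:ℤ) + ν) (n:ℤ) := by
          refine Finset.sum_le_sum fun μ _ => Finset.sum_le_sum fun n hn => ?_
          exact (mul_le_mul_left (hT _ (Finset.mem_Icc.mp hn).2) _).trans (hTF _ n)
      _ = ENNReal.ofReal C₁ *
            ∑ μ ∈ Finset.Ico N (2 * N), ∑ n ∈ Finset.Icc 1 N, F ((μ:ℤ) + ν) (n:ℤ) := by
          simp only [Finset.mul_sum]
      _ ≤ ENNReal.ofReal C₁ * ENNReal.ofReal (|B| * N) := by
          refine mul_le_mul_right (hcarl.trans (ENNReal.ofReal_le_ofReal ?_)) _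
          exact mul_le_mul_of_nonneg_right (le_abs_self B) hN0.le
  have hdiv : C₁ * |B| * (2 * 2 ^ s) * (N:ℝ) ^ (-s) = C₁ * (|B| * N) / w := by
    rw [hw, Real.div_rpow hN0.le (by norm_num), Real.rpow_neg hN0.le]
    have h1 : (0:ℝ) < (N:ℝ) ^ s := by positivity
    have h2 : (0:ℝ) < (2:ℝ) ^ s := by positivity
    field_simp
  rw [hdiv, ENNReal.ofReal_div_of_pos hw0, ENNReal.ofReal_mul hC₁]
  rw [ENNReal.le_div_iff_mul_le (Or.inl (by simpa using hw0)) (Or.inl ENNReal.ofReal_ne_top)]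
  exact hXw

theorem sum_range_two_pow_le {a : ℕ → ℝ≥0∞} {b : ℕ → ℝ≥0∞}
    (h : ∀ m, ∑ μ ∈ Finset.Ico (2 ^ m) (2 * 2 ^ m), a μ ≤ b m) (M : ℕ) :
    ∑ μ ∈ Finset.range (2 ^ M), a μ ≤ a 0 + ∑ m ∈ Finset.range M, b m := by
  induction M with
  | zero => simp
  | succ M ih =>
    have hle : 2 ^ M ≤ 2 * 2 ^ M := by omega
    rw [pow_succ', ← Finset.sum_range_add_sum_Ico a hle, Finset.sum_range_succ, ← add_assoc]
    exact add_le_add ih (h M)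

theorem tsum_le_add_tsum_of_dyadic {a : ℕ → ℝ≥0∞} {b : ℕ → ℝ≥0∞}
    (h : ∀ m, ∑ μ ∈ Finset.Ico (2 ^ m) (2 * 2 ^ m), a μ ≤ b m) :
    ∑' μ, a μ ≤ a 0 + ∑' m, b m := by
  rw [ENNReal.tsum_eq_iSup_nat (f := a)]
  refine iSup_le fun M => ?_
  calc ∑ μ ∈ Finset.range M, a μ
      ≤ ∑ μ ∈ Finset.range (2 ^ M), a μ :=
        Finset.sum_le_sum_of_subset (Finset.range_subset_range.mpr Nat.lt_two_pow_self.le)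
    _ ≤ a 0 + ∑ m ∈ Finset.range M, b m := sum_range_two_pow_le h M
    _ ≤ a 0 + ∑' m, b m := by gcongr; exact ENNReal.sum_le_tsum _

/-- Lemma 6.2: under `(R̃_{p_d})` and the Carleson condition `(C̃_{p_d})`,
`sup_ν ∑_μ (∑_{J ∈ 𝒥^{μ+ν}_μ} card J) 2^{-μ} < ∞`. -/
theorem diagonal_sum_bound_of_regular_family (d : ℕ) (hd : 2 ≤ d)
    (E : Set ℝ) (hE : E ⊆ Set.Ioi (0:ℝ))
    (𝒥 : ℤ → Set (Set ℝ)) (C : ℝ)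
    (hcore : RegFamilyCore E d ((d:ℝ) / ((d:ℝ) - 1)) 𝒥 C)
    (hcard : CardCondTilde E 𝒥 C)
    (hCarl : CondCarleson E d) :
    ∃ B : ℝ, ∀ ν : ℤ,
      (∑' μ : ℕ, (∑' J : (Jmu 𝒥 C ((μ:ℤ) + ν) μ), ((J : Set ℝ).ncard : ℝ≥0∞)) *
          ENNReal.ofReal ((2:ℝ) ^ (-(μ:ℝ)))) ≤ ENNReal.ofReal B := by
  obtain ⟨C₁, hC₁, hTle⟩ := hcard
  have hC₁0 : 0 ≤ C₁ := by linarith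
  set A : ℤ → ℕ → ℝ≥0∞ := fun k μ => ∑' J : (Jmu 𝒥 C k μ), ((J : Set ℝ).ncard : ℝ≥0∞) with hA
  set T : ℤ → ℕ → ℝ≥0∞ := fun k n =>
    ∑' μ : {μ : ℕ // n ≤ μ}, ENNReal.ofReal ((2:ℝ) ^ (-(μ.1:ℝ))) * A k μ.1 with hTdef
  have hT : ∀ k, Antitone (T k) := fun k m n hmn =>
    ENNReal.tsum_mono_subtype (fun μ : ℕ => ENNReal.ofReal ((2:ℝ) ^ (-(μ:ℝ))) * A k μ)
      (s := {μ | n ≤ μ}) (t := {μ | m ≤ μ}) fun μ hμ => le_trans hmn hμ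
  have hAT : ∀ (k : ℤ) (n μ : ℕ), n ≤ μ → A k μ * ENNReal.ofReal ((2:ℝ) ^ (-(μ:ℝ))) ≤ T k n := by
    intro k n μ h
    rw [mul_comm]
    exact ENNReal.le_tsum (f := fun μ : {μ : ℕ // n ≤ μ} =>
      ENNReal.ofReal ((2:ℝ) ^ (-(μ.1:ℝ))) * A k μ.1) ⟨μ, h⟩
  obtain ⟨D, hD, hblock⟩ := sum_tail_le_of_condCarleson hd hCarl hT hTle hC₁0
  set s : ℝ := 1 / ((d:ℝ) - 1) with hs_def
  have hd' : (2:ℝ) ≤ d := by exact_mod_cast hd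
  have hs : 0 < s := by rw [hs_def]; exact div_pos zero_lt_one (by linarith)
  have hr0 : (0:ℝ) ≤ 2 ^ (-s) := by positivity
  have hr1 : (2:ℝ) ^ (-s) < 1 := Real.rpow_lt_one_of_one_lt_of_neg one_lt_two (by linarith)
  have hgeom : Summable fun m : ℕ => D * ((2:ℝ) ^ (-s)) ^ m :=
    (summable_geometric_of_lt_one hr0 hr1).mul_left D
  refine ⟨C₁ + ∑' m : ℕ, D * ((2:ℝ) ^ (-s)) ^ m, fun ν => ?_⟩
  have hzero : A ((0:ℕ) + ν) 0 * ENNReal.ofReal ((2:ℝ) ^ (-((0:ℕ):ℝ))) ≤ ENNReal.ofReal C₁ := by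
    refine (hAT _ 0 0 le_rfl).trans ((hTle _ 0).trans ?_)
    have hcov : covN (Ek E ((0:ℕ) + ν)) ((2:ℝ) ^ (((0:ℕ) + ν) - ((0:ℕ):ℤ))) ≤ 1 := by
      refine covN_le_one_of_subset_Icc (c := (2:ℝ) ^ ν) fun t ht => ?_
      have h2 := ht.2
      simp only [Nat.cast_zero, zero_add, Set.mem_Ico] at h2
      rw [zpow_add_one₀ two_ne_zero] at h2
      simp only [Nat.cast_zero, zero_add, sub_zero, Set.mem_Icc]
      exact ⟨h2.1, by linarith [h2.2]⟩
    calc _ ≤ ENNReal.ofReal (C₁ * (2:ℝ) ^ (-((0:ℕ):ℝ))) * 1 := by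
          gcongr
          exact_mod_cast hcov
      _ = ENNReal.ofReal C₁ := by simp
  have hdyadic : ∀ m : ℕ, ∑ μ ∈ Finset.Ico (2 ^ m : ℕ) (2 * 2 ^ m),
      A ((μ:ℤ) + ν) μ * ENNReal.ofReal ((2:ℝ) ^ (-(μ:ℝ))) ≤
        ENNReal.ofReal (D * ((2:ℝ) ^ (-s)) ^ m) := by
    intro m
    refine (Finset.sum_le_sum fun μ hμ => hAT _ (2 ^ m) μ (Finset.mem_Ico.mp hμ).1).trans
      ((hblock ν (2 ^ m) Nat.one_le_two_pow).trans (le_of_eq ?_))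
    rw [Nat.cast_pow, Nat.cast_ofNat, Real.rpow_pow_comm (by norm_num)]
  refine (tsum_le_add_tsum_of_dyadic hdyadic).trans ?_
  rw [ENNReal.ofReal_add hC₁0 (tsum_nonneg fun m => by positivity),
    ENNReal.ofReal_tsum_of_nonneg (fun m => by positivity) hgeom]
  exact add_le_add hzero le_rfl
end
end
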